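/- arXiv:1801.03343 — 2 statements merged into one kernel-verified Lean document; each statement's English description precedes it below -/
import Mathlib

section
/- Let f be an exact area-preserving twist map of the annulus 𝕋 × ℝ, and let T₀ and T₁ be two invariant curves for f (i.e. essential topological circles with f(T₀)=T₀ and f(T₁)=T₁) such that the restrictions f|_{T₀} and f|_{T₁} have the same rotation number α, with α irrational. Then T₀ = T₁. -/
/-!
STATEMENT 0 (uniqueness of invariant curves with a given irrational rotation
number for an exact area-preserving twist map of the annulus 𝕋 × ℝ, 𝕋 = ℝ/ℤ).

We work on the universal cover ℝ² of the annulus.  An exact area-preserving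
twist map is given by a smooth generating function `h : ℝ² → ℝ`, 1-periodic in
the first variable, whose associated lift `F : ℝ² → ℝ²`, `F (θ, I) = (Θ, 𝓘)`,
is defined implicitly by `𝓘 = I - ∂_θ h (θ, 𝓘)` and `Θ = θ + ∂_𝓘 h (θ, 𝓘)`,
and which satisfies the twist condition (a1) and the condition (a2) at infinity.

An (essential topological) invariant circle is described by its lift
`T ⊆ ℝ²`, parametrized by a continuous injective `Γ : ℝ → ℝ²` with
`Γ (x + 1) = Γ x + (1, 0)`; the rotation number of the restriction of the map
to the circle is the translation number of a monotone degree-one lift `u` of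
the induced circle homeomorphism, characterized by `F (Γ x) = Γ (u x)`.
-/

/-- The data and axioms of an exact area-preserving twist map of the annulus
`𝕋 × ℝ`, given by its lift `F` to the universal cover `ℝ²` together with its
generating function `h`. -/
structure TwistMap where
  /-- the generating function, as a function of `(θ, 𝓘)` -/
  h : ℝ → ℝ → ℝ
  /-- the lift of the twist map to the universal cover `ℝ²` -/
  F : ℝ × ℝ → ℝ × ℝ
  smooth_h : ContDiff ℝ (⊤ : ℕ∞) (Function.uncurry h)
  periodic_h : ∀ θ I, h (θ + 1) I = h θ I
  smooth_F : ContDiff ℝ (⊤ : ℕ∞) F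
  bijective_F : Function.Bijective F
  periodic_F : ∀ θ I, F (θ + 1, I) = F (θ, I) + (1, 0)
  /-- `𝓘 = I - ∂_θ h (θ, 𝓘)` -/
  gen_snd : ∀ θ I, (F (θ, I)).2 = I - deriv (fun t => h t (F (θ, I)).2) θ
  /-- `Θ = θ + ∂_𝓘 h (θ, 𝓘)` -/
  gen_fst : ∀ θ I, (F (θ, I)).1 = θ + deriv (fun J => h θ J) (F (θ, I)).2
  /-- (a1): the twist condition `∂_I Θ (θ, I) > 0` -/
  twist : ∀ θ I, 0 < deriv (fun J => (F (θ, J)).1) I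
  /-- (a2): `|Θ| → +∞` as `|I| → +∞`, uniformly in `θ` (on the annulus, i.e.
  for `θ` in a fundamental domain). -/
  infinity : ∀ C : ℝ, 0 < C → ∃ R : ℝ, 0 < R ∧
    ∀ θ ∈ Set.Icc (0:ℝ) 1, ∀ I : ℝ, R ≤ |I| → C ≤ |(F (θ, I)).1|

/-- `Γ : ℝ → ℝ²` is the lift of a parametrization of an essential topological
circle in the annulus `𝕋 × ℝ` : it is continuous, injective (equivalently, the
induced map of the circle `𝕋` into the annulus is injective) and commutes with
the deck transformation. -/
def IsEssentialCircleParam (Γ : ℝ → ℝ × ℝ) : Prop :=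
  Continuous Γ ∧ Function.Injective Γ ∧ ∀ x, Γ (x + 1) = Γ x + (1, 0)

/-- `T ⊆ ℝ²` is the lift of an essential topological circle in the annulus. -/
def IsEssentialCircle (T : Set (ℝ × ℝ)) : Prop :=
  ∃ Γ : ℝ → ℝ × ℝ, IsEssentialCircleParam Γ ∧ Set.range Γ = T

/-- The restriction of the twist map with lift `F` to the invariant essential
circle (with lift) `T` has rotation number `α` : for some parametrization `Γ`
of `T`, the induced circle homeomorphism admits a monotone degree-one lift
`u : ℝ → ℝ` (so `u` is a `CircleDeg1Lift`), i.e. `F (Γ x) = Γ (u x)` for all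
`x`, whose translation number is `α`. -/
def RestrictionHasRotationNumber (F : ℝ × ℝ → ℝ × ℝ) (T : Set (ℝ × ℝ)) (α : ℝ) : Prop :=
  ∃ Γ : ℝ → ℝ × ℝ, IsEssentialCircleParam Γ ∧ Set.range Γ = T ∧
    ∃ u : CircleDeg1Lift, (∀ x, F (Γ x) = Γ (u x)) ∧ u.translationNumber = α

section PlaneSeparation

open Set Topology Filter

/-- For a path `γ` in the plane, the function `z ↦ (z - γ 1) / (z - γ 0)` has a continuous
logarithm off `γ`, which is the principal one near infinity. -/
lemma exists_log_off_path (γ : C(unitInterval, ℂ)) :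
    ∃ L : ℂ → ℂ, ContinuousOn L (range γ)ᶜ ∧
      (∀ z ∉ range γ, Complex.exp (L z) = (z - γ 1) / (z - γ 0)) ∧
      ∃ R : ℝ, ∀ z, R < ‖z‖ → z ∉ range γ ∧ L z = Complex.log ((z - γ 1) / (z - γ 0)) := by
  classical
  let U : Set ℂ := (range γ)ᶜ
  have hne (z : U) (t : unitInterval) : (z : ℂ) - γ t ≠ 0 := fun h =>
    z.2 ⟨t, (sub_eq_zero.1 h).symm⟩
  let H : C(unitInterval × U, {z : ℂ // z ≠ 0}) :=
    ⟨fun q => ⟨(q.2 - γ q.1) / (q.2 - γ 0), div_ne_zero (hne _ _) (hne _ _)⟩, by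
      refine Continuous.subtype_mk (Continuous.div ?_ ?_ fun q => hne _ _) _ <;> fun_prop⟩
  have H_0 : ∀ a : U, H (0, a) =
      (fun z : ℂ ↦ (⟨_, z.exp_ne_zero⟩ : {z : ℂ // z ≠ 0})) (ContinuousMap.const U (0 : ℂ) a) := by
    intro a
    apply Subtype.ext
    simp [H, div_self (hne a 0)]
  let Λ := Complex.isCoveringMap_exp.liftHomotopy H (ContinuousMap.const U 0) H_0
  have hΛ : ∀ q, Complex.exp (Λ q) = (q.2 - γ q.1) / (q.2 - γ 0) := by
    intro q
    have := congrFun (Complex.isCoveringMap_exp.liftHomotopy_lifts H (ContinuousMap.const U 0) H_0) q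
    exact congrArg Subtype.val this
  let L : ℂ → ℂ := fun z => if h : z ∉ range γ then Λ (1, ⟨z, h⟩) else 0
  have hL : ∀ z (h : z ∉ range γ), L z = Λ (1, ⟨z, h⟩) := fun z h => dif_pos h
  refine ⟨L, ?_, ?_, ?_⟩
  · rw [continuousOn_iff_continuous_domRestrict]
    have : (range γ)ᶜ.domRestrict L = fun z : U => Λ (1, z) := by
      ext z
      exact hL z z.2
    rw [this]
    fun_prop
  · intro z hz
    rw [hL z hz, hΛ]
  · obtain ⟨M, hM⟩ := (isCompact_range γ.continuous).isBounded.exists_norm_le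
    have hM' : ∀ t, ‖γ t‖ ≤ M := fun t => hM _ ⟨t, rfl⟩
    refine ⟨3 * M, fun z hz => ?_⟩
    have hM0 : 0 ≤ M := (norm_nonneg _).trans (hM' 0)
    have hzr : z ∉ range γ := fun h => by linarith [hM z h]
    refine ⟨hzr, ?_⟩
    have hslit : ∀ t, (z - γ t) / (z - γ 0) ∈ Complex.slitPlane := by
      intro t
      suffices h : ‖(z - γ t) / (z - γ 0) - 1‖ < 1 by
        simpa using Complex.mem_slitPlane_of_norm_lt_one h
      have h0 : z - γ 0 ≠ 0 := hne ⟨z, hzr⟩ 0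
      rw [div_sub_one h0, norm_div, div_lt_one (norm_pos_iff.2 h0)]
      calc ‖z - γ t - (z - γ 0)‖ = ‖γ 0 - γ t‖ := by ring_nf
        _ ≤ ‖γ 0‖ + ‖γ t‖ := norm_sub_le _ _
        _ < ‖z‖ - ‖γ 0‖ := by linarith [hM' 0, hM' t]
        _ ≤ ‖z - γ 0‖ := norm_sub_norm_le _ _
    rw [hL z hzr]
    have key := (Complex.isCoveringMap_exp.eq_liftPath_iff
      (γ := ⟨fun t => H (t, ⟨z, hzr⟩), by fun_prop⟩) (e := 0) (by simpa using H_0 ⟨z, hzr⟩)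
      (Γ := fun t => Complex.log ((z - γ t) / (z - γ 0)))).2 ⟨?_, ?_, ?_⟩
    · exact (congrFun key 1).symm
    · exact Continuous.clog (by fun_prop) hslit
    · ext t
      simp only [Function.comp_apply, ContinuousMap.coe_mk, H]
      exact Complex.exp_log (Complex.slitPlane_ne_zero (hslit t))
    · simp [div_self (hne ⟨z, hzr⟩ 0)]

/-- There is no continuous logarithm of `(z - b) / (z - a)` on the plane minus `{a, b}`. -/
lemma not_exists_log_two_points {a b : ℂ} (hab : a ≠ b) {L : ℂ → ℂ}
    (hL : ContinuousOn L {a, b}ᶜ)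
    (hexp : ∀ z, z ≠ a → z ≠ b → Complex.exp (L z) = (z - b) / (z - a)) : False := by
  have hba : b - a ≠ 0 := sub_ne_zero.2 hab.symm
  let c : ℝ → ℂ := fun θ => a + (b - a) / 2 * Complex.exp (θ * Complex.I)
  have hn : ∀ θ : ℝ, ‖Complex.exp (θ * Complex.I)‖ = 1 := Complex.norm_exp_ofReal_mul_I
  have hca : ∀ θ, c θ ≠ a := fun θ h => by
    have : (b - a) / 2 * Complex.exp (θ * Complex.I) = 0 := by simpa [c] using h
    simp [hba] at this
  let d : ℝ → ℂ := fun θ => 1 - Complex.exp (θ * Complex.I) / 2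
  have hd : ∀ θ, d θ ∈ Complex.slitPlane := fun θ => by
    have := Complex.mem_slitPlane_of_norm_lt_one (z := -(Complex.exp (θ * Complex.I) / 2))
      (by rw [norm_neg, norm_div, hn]; norm_num)
    simpa [d, sub_eq_add_neg] using this
  have hdc : ∀ θ, c θ - b = -(b - a) * d θ := fun θ => by simp only [c, d]; ring
  have hcb : ∀ θ, c θ ≠ b := fun θ h => by
    have := hdc θ
    rw [h, sub_self, eq_comm, mul_eq_zero, neg_eq_zero] at this
    exact this.elim hba (Complex.slitPlane_ne_zero (hd θ))
  let g : ℝ → ℂ := fun θ => L (c θ) - Complex.log (d θ) + θ * Complex.I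
  have hg : Continuous g := by
    refine ((hL.comp_continuous (by fun_prop) fun θ => ?_).sub
      (Continuous.clog (by fun_prop) hd)).add (by fun_prop)
    simp [hca, hcb]
  have hge : ∀ θ, Complex.exp (g θ) = -2 := fun θ => by
    have hd0 := Complex.slitPlane_ne_zero (hd θ)
    have he := Complex.exp_ne_zero (θ * Complex.I)
    simp only [g]
    rw [Complex.exp_add, Complex.exp_sub, hexp _ (hca θ) (hcb θ), Complex.exp_log hd0, hdc]
    have : c θ - a = (b - a) / 2 * Complex.exp (θ * Complex.I) := by simp [c]
    rw [this]
    field_simp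
  have hg1 : g (2 * Real.pi) - g 0 = 2 * Real.pi * Complex.I := by
    have : c (2 * Real.pi) = c 0 := by simp [c]
    have h2 : d (2 * Real.pi) = d 0 := by simp [d]
    simp [g, this, h2]
  have hcont : Continuous fun θ => (g θ - g 0).im := by fun_prop
  obtain ⟨θ, -, hθ⟩ := intermediate_value_Icc (by positivity : (0 : ℝ) ≤ 2 * Real.pi)
    hcont.continuousOn (show Real.pi ∈ Icc _ _ by
      rw [hg1]; simp [Real.pi_pos.le]; linarith [Real.pi_pos])
  have h1 : Complex.exp (g θ - g 0) = 1 := by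
    rw [Complex.exp_sub, hge, hge]; norm_num
  have h2 := congrArg Complex.re h1
  simp only [] at hθ
  rw [Complex.exp_re, hθ, Real.cos_pi, Complex.one_re] at h2
  linarith [Real.exp_pos (g θ - g 0).re]

/-- Two paths with the same distinct endpoints and no other common point bound an open set. -/
lemma exists_isOpen_frontier_subset_of_paths (γ δ : C(unitInterval, ℂ)) (h0 : γ 0 = δ 0)
    (h1 : γ 1 = δ 1) (hne : γ 0 ≠ γ 1) (hinter : range γ ∩ range δ ⊆ {γ 0, γ 1}) :
    ∃ C : Set ℂ, IsOpen C ∧ C.Nonempty ∧ Bornology.IsBounded C ∧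
      frontier C ⊆ range γ ∪ range δ := by
  classical
  obtain ⟨L, hL, hLe, R, hR⟩ := exists_log_off_path γ
  obtain ⟨L', hL', hLe', R', hR'⟩ := exists_log_off_path δ
  have hγ : IsClosed (range γ) := (isCompact_range γ.continuous).isClosed
  have hδ : IsClosed (range δ) := (isCompact_range δ.continuous).isClosed
  have hK : IsOpen (range γ ∪ range δ)ᶜ := (hγ.union hδ).isOpen_compl
  have hdiff : ContinuousOn (fun z => L z - L' z) (range γ ∪ range δ)ᶜ :=
    (hL.mono (compl_subset_compl.2 subset_union_left)).sub
      (hL'.mono (compl_subset_compl.2 subset_union_right))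
  have hsmall : ∀ z ∈ (range γ ∪ range δ)ᶜ, ‖L z - L' z‖ < 1 → L z = L' z := by
    intro z hz hlt
    simp only [mem_compl_iff, mem_union, not_or] at hz
    have : Complex.exp (L z - L' z) = 1 := by
      rw [Complex.exp_sub, hLe z hz.1, hLe' z hz.2, h0, h1]
      exact div_self (div_ne_zero (fun h => hz.2 ⟨1, (sub_eq_zero.1 h).symm⟩)
        (fun h => hz.2 ⟨0, (sub_eq_zero.1 h).symm⟩))
    obtain ⟨n, hn⟩ := Complex.exp_eq_one_iff.1 this
    rw [hn] at hlt
    by_cases hn0 : n = 0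
    · simpa [hn0, sub_eq_zero] using hn
    · exfalso
      have : (1 : ℝ) ≤ |(n : ℝ)| := by exact_mod_cast Int.one_le_abs hn0
      simp [abs_of_pos Real.pi_pos] at hlt
      nlinarith [Real.pi_gt_three]
  refine ⟨(range γ ∪ range δ)ᶜ ∩ (fun z => L z - L' z) ⁻¹' {0}ᶜ,
    hdiff.isOpen_inter_preimage hK isOpen_compl_singleton, ?_, ?_, ?_⟩
  · by_contra hemp
    rw [not_nonempty_iff_eq_empty, eq_empty_iff_forall_notMem] at hemp
    have heq : ∀ z, z ∉ range γ → z ∉ range δ → L z = L' z := fun z hz hz' => by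
      by_contra h
      exact hemp z ⟨fun h => h.elim hz hz', sub_ne_zero.2 h⟩
    refine not_exists_log_two_points (L := fun z => if z ∈ range γ then L' z else L z) hne ?_ ?_
    · intro z hz
      apply ContinuousAt.continuousWithinAt
      by_cases hzγ : z ∈ range γ
      · have hzδ : z ∉ range δ := fun h => hz (hinter ⟨hzγ, h⟩)
        have hnhds := hδ.isOpen_compl.mem_nhds hzδ
        refine (hL'.continuousAt hnhds).congr ?_
        filter_upwards [hnhds] with w hw
        split_ifs with h
        · rfl
        · exact (heq w h hw).symm
      · have hnhds := hγ.isOpen_compl.mem_nhds hzγ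
        refine (hL.continuousAt hnhds).congr ?_
        filter_upwards [hnhds] with w hw
        rw [if_neg hw]
    · intro z hz0 hz1
      split_ifs with h
      · rw [hLe' z fun h' => by simpa [hz0, hz1] using hinter ⟨h, h'⟩, h0, h1]
      · exact hLe z h
  · refine (Metric.isBounded_closedBall (x := (0 : ℂ)) (r := max R R')).subset fun z hz => ?_
    rw [mem_closedBall_zero_iff]
    by_contra! h
    rw [max_lt_iff] at h
    exact hz.2 (by simp [(hR z h.1).2, (hR' z h.2).2, h0, h1])
  · intro z hz
    by_contra hzK
    have hopen := hdiff.isOpen_inter_preimage hK isOpen_compl_singleton (t := {(0 : ℂ)}ᶜ)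
    rw [hopen.frontier_eq] at hz
    have hz0 : L z - L' z = 0 := by
      by_contra h
      exact hz.2 ⟨hzK, h⟩
    have hcont := hdiff.continuousAt (hK.mem_nhds hzK)
    have hev : ∀ᶠ w in 𝓝 z, ‖L w - L' w‖ < 1 := by
      have := hcont.norm.eventually_lt_const (u := (1 : ℝ)) (by simp [hz0])
      exact this
    obtain ⟨w, ⟨hw1, hw2⟩, hw3⟩ := mem_closure_iff_nhds.1 hz.1 _ (hev.and (hK.mem_nhds hzK))
      |>.imp fun w hw => hw
    exact hw3.2 (sub_eq_zero.2 (hsmall w hw2 hw1))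

end PlaneSeparation

section Wandering

open Set Topology Metric MeasureTheory

lemma subset_closedBall_of_frontier_subset {E : Type*} [NormedAddCommGroup E] [NormedSpace ℝ E]
    {C : Set E} (hC : IsOpen C) (hb : Bornology.IsBounded C) {c : E} {ε : ℝ} (hε : 0 ≤ ε)
    (hfr : frontier C ⊆ closedBall c ε) : C ⊆ closedBall c ε := by
  intro x hx
  by_contra hxc
  rw [mem_closedBall, dist_eq_norm, not_le] at hxc
  set S : Set E := (fun s : ℝ => x + s • (x - c)) '' Ici 0 with hS
  have hSpre : IsPreconnected S := isPreconnected_Ici.image _ (by fun_prop)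
  have hSfr : ∀ y ∈ S, y ∉ frontier C := by
    rintro _ ⟨s, hs, rfl⟩ hy
    have h := hfr hy
    have hs0 : (0 : ℝ) ≤ s := hs
    have heq : x + s • (x - c) - c = (1 + s) • (x - c) := by module
    rw [mem_closedBall, dist_eq_norm, heq, norm_smul, Real.norm_of_nonneg (by positivity)] at h
    nlinarith [norm_nonneg (x - c)]
  have hSC : S ⊆ C := by
    refine hSpre.subset_left_of_subset_union hC isClosed_closure.isOpen_compl
      (disjoint_compl_right_iff_subset.2 subset_closure) (fun y hy => ?_)
      ⟨x, ⟨0, by simp, by simp⟩, hx⟩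
    by_cases hyC : y ∈ closure C
    · left
      by_contra hyn
      exact hSfr y hy (by rw [hC.frontier_eq]; exact ⟨hyC, hyn⟩)
    · exact Or.inr hyC
  obtain ⟨R, hR⟩ := hb.subset_closedBall c
  have hpos : 0 < ‖x - c‖ := hε.trans_lt hxc
  have h := hR (hSC ⟨|R| / ‖x - c‖, by simp only [mem_Ici]; positivity, rfl⟩)
  have heq : x + (|R| / ‖x - c‖) • (x - c) - c = (1 + |R| / ‖x - c‖) • (x - c) := by module
  rw [mem_closedBall, dist_eq_norm, heq, norm_smul, Real.norm_of_nonneg (by positivity), add_mul,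
    div_mul_cancel₀ _ hpos.ne'] at h
  linarith [le_abs_self R]

/-- An area-preserving homeomorphism of the plane cannot shrink a closed curve made of two arcs
to a point. -/
lemma not_forall_exists_iterate_image_subset_closedBall (F : ℝ × ℝ ≃ₜ ℝ × ℝ)
    (hF : ∀ S, MeasurableSet S → volume (F '' S) = volume S) (γ δ : C(unitInterval, ℝ × ℝ))
    (h0 : γ 0 = δ 0) (h1 : γ 1 = δ 1) (hne : γ 0 ≠ γ 1)
    (hinter : range γ ∩ range δ ⊆ {γ 0, γ 1})
    (h : ∀ ε > 0, ∃ (n : ℕ) (c : ℝ × ℝ), F^[n] '' (range γ ∪ range δ) ⊆ closedBall c ε) :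
    False := by
  set e : ℂ ≃ₜ ℝ × ℝ := Complex.equivRealProdCLM.toHomeomorph with he
  obtain ⟨C, hCo, hCne, hCb, hCfr⟩ := exists_isOpen_frontier_subset_of_paths
    ((ContinuousMap.mk e.symm e.symm.continuous).comp γ)
    ((ContinuousMap.mk e.symm e.symm.continuous).comp δ)
    (congrArg e.symm h0) (congrArg e.symm h1) (fun h => hne (e.symm.injective h)) (by
      rintro _ ⟨⟨s, rfl⟩, t, ht⟩
      have : γ s ∈ range γ ∩ range δ := ⟨⟨s, rfl⟩, t, e.symm.injective ht⟩
      rcases hinter this with h | h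
      · exact Or.inl (congrArg e.symm h)
      · exact Or.inr (congrArg e.symm h))
  set D : Set (ℝ × ℝ) := e '' C with hD
  have hDo : IsOpen D := e.isOpenMap _ hCo
  have hDne : D.Nonempty := hCne.image _
  have hDc : IsCompact (closure D) := by
    rw [hD, ← e.image_closure]
    exact hCb.isCompact_closure.image e.continuous
  have hDfr : frontier D ⊆ range γ ∪ range δ := by
    rw [hD, ← e.image_frontier]
    rintro _ ⟨z, hz, rfl⟩
    rcases hCfr hz with ⟨s, rfl⟩ | ⟨s, rfl⟩
    · exact Or.inl ⟨s, (e.apply_symm_apply _).symm⟩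
    · exact Or.inr ⟨s, (e.apply_symm_apply _).symm⟩
  have hiter : ∀ n : ℕ, ∃ G : ℝ × ℝ ≃ₜ ℝ × ℝ, ⇑G = F^[n] ∧ volume (G '' D) = volume D := by
    intro n
    induction n with
    | zero => exact ⟨Homeomorph.refl _, rfl, by simp⟩
    | succ n ih =>
      obtain ⟨G, hG, hGv⟩ := ih
      refine ⟨G.trans F, by rw [Function.iterate_succ', ← hG]; rfl, ?_⟩
      rw [show ⇑(G.trans F) = F ∘ G from rfl, image_comp, hF _ (G.isOpenMap _ hDo).measurableSet, hGv]
  have hpos : 0 < volume D := hDo.measure_pos _ hDne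
  have hle : ∀ ε > 0, volume D ≤ ENNReal.ofReal (2 * ε) * ENNReal.ofReal (2 * ε) := by
    intro ε hε
    obtain ⟨n, c, hn⟩ := h ε hε
    obtain ⟨G, hG, hGv⟩ := hiter n
    have hsub : G '' D ⊆ closedBall c ε := by
      refine subset_closedBall_of_frontier_subset (G.isOpenMap _ hDo)
        ((hDc.image G.continuous).isBounded.subset (image_mono subset_closure)) hε.le ?_
      rw [← G.image_frontier, hG]
      exact (image_mono hDfr).trans hn
    calc volume D = volume (G '' D) := hGv.symm
      _ ≤ volume (closedBall c ε) := measure_mono hsub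
      _ = _ := by
        rw [← Prod.mk.eta (p := c), ← closedBall_prod_same, Measure.volume_eq_prod,
          Measure.prod_prod, Real.volume_closedBall, Real.volume_closedBall]
  have hlim : Filter.Tendsto (fun ε : ℝ => ENNReal.ofReal (2 * ε * (2 * ε))) (𝓝[>] 0) (𝓝 0) := by
    have : Filter.Tendsto (fun ε : ℝ => ENNReal.ofReal (2 * ε * (2 * ε))) (𝓝 0)
        (𝓝 (ENNReal.ofReal (2 * 0 * (2 * 0)))) :=
      (ENNReal.continuous_ofReal.comp (by fun_prop)).tendsto _
    simpa using this.mono_left nhdsWithin_le_nhds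
  refine hpos.not_ge (ge_of_tendsto hlim ?_)
  filter_upwards [self_mem_nhdsWithin] with ε hε
  have hε' : (0 : ℝ) < ε := hε
  rw [ENNReal.ofReal_mul (by positivity)]
  exact hle ε hε

end Wandering

section TwistGeometry

open Set MeasureTheory ContinuousLinearMap

lemma ContinuousLinearMap.det_prod_snd (l : ℝ × ℝ →L[ℝ] ℝ) :
    (l.prod (ContinuousLinearMap.snd ℝ ℝ ℝ)).det = l (1, 0) := by
  rw [ContinuousLinearMap.det, ← LinearMap.det_toMatrix (Module.Basis.finTwoProd ℝ),
    Matrix.det_fin_two]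
  simp [LinearMap.toMatrix_apply]

lemma ContinuousLinearMap.det_fst_prod (l : ℝ × ℝ →L[ℝ] ℝ) :
    ((ContinuousLinearMap.fst ℝ ℝ ℝ).prod l).det = l (0, 1) := by
  rw [ContinuousLinearMap.det, ← LinearMap.det_toMatrix (Module.Basis.finTwoProd ℝ),
    Matrix.det_fin_two]
  simp [LinearMap.toMatrix_apply]

namespace TwistMap

variable (f : TwistMap)

/-- The differential of the generating function. -/
noncomputable def dh : ℝ × ℝ → (ℝ × ℝ →L[ℝ] ℝ) := fderiv ℝ (Function.uncurry f.h)

/-- The angle of the image, as a function of `(θ, 𝓘)`. -/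
noncomputable def newAngle (x : ℝ × ℝ) : ℝ := x.1 + f.dh x (0, 1)

/-- The action of the source, as a function of `(θ, 𝓘)`. -/
noncomputable def oldAction (x : ℝ × ℝ) : ℝ := x.2 + f.dh x (1, 0)

/-- The common Jacobian `1 + ∂_θ ∂_𝓘 h` of `newAngle` and `oldAction`. -/
noncomputable def jac (x : ℝ × ℝ) : ℝ := 1 + fderiv ℝ f.dh x (1, 0) (0, 1)

lemma contDiff_dh : ContDiff ℝ (⊤ : ℕ∞) f.dh :=
  f.smooth_h.fderiv_right (m := (⊤ : ℕ∞)) (by simp)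

lemma hasStrictFDerivAt_dh (x : ℝ × ℝ) : HasStrictFDerivAt f.dh (fderiv ℝ f.dh x) x :=
  f.contDiff_dh.contDiffAt.hasStrictFDerivAt (by simp)

lemma dh_symm (x v w : ℝ × ℝ) : fderiv ℝ f.dh x v w = fderiv ℝ f.dh x w v :=
  (f.smooth_h.contDiffAt (x := x)).isSymmSndFDerivAt
    (by simpa using WithTop.coe_le_coe.2 (le_top : (2 : ℕ∞) ≤ ⊤)) v w

lemma continuous_jac : Continuous f.jac := by
  have h : Continuous (fderiv ℝ f.dh) := f.contDiff_dh.continuous_fderiv (by simp)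
  unfold jac
  fun_prop

lemma deriv_h_fst (θ J : ℝ) : deriv (fun t => f.h t J) θ = f.dh (θ, J) (1, 0) := by
  have h1 : HasFDerivAt (Function.uncurry f.h) (f.dh (θ, J)) (θ, J) :=
    (f.smooth_h.differentiable (by simp) _).hasFDerivAt
  have h2 : HasDerivAt (fun t : ℝ => (t, J)) (1, 0) θ :=
    (hasDerivAt_id θ).prodMk (hasDerivAt_const θ J)
  exact (h1.comp_hasDerivAt θ h2).deriv

lemma deriv_h_snd (θ J : ℝ) : deriv (fun t => f.h θ t) J = f.dh (θ, J) (0, 1) := by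
  have h1 : HasFDerivAt (Function.uncurry f.h) (f.dh (θ, J)) (θ, J) :=
    (f.smooth_h.differentiable (by simp) _).hasFDerivAt
  have h2 : HasDerivAt (fun t : ℝ => (θ, t)) (0, 1) J :=
    (hasDerivAt_const J θ).prodMk (hasDerivAt_id J)
  exact (h1.comp_hasDerivAt J h2).deriv

lemma hasStrictFDerivAt_newAngle (x : ℝ × ℝ) :
    HasStrictFDerivAt f.newAngle
      (fst ℝ ℝ ℝ + (fderiv ℝ f.dh x).flip (0, 1)) x :=
  hasStrictFDerivAt_fst.add
    ((f.hasStrictFDerivAt_dh x).clm_apply (hasStrictFDerivAt_const (0, 1) x) |>.congr_fderiv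
      (by simp))

lemma hasStrictFDerivAt_oldAction (x : ℝ × ℝ) :
    HasStrictFDerivAt f.oldAction
      (snd ℝ ℝ ℝ + (fderiv ℝ f.dh x).flip (1, 0)) x :=
  hasStrictFDerivAt_snd.add
    ((f.hasStrictFDerivAt_dh x).clm_apply (hasStrictFDerivAt_const (1, 0) x) |>.congr_fderiv
      (by simp))

lemma hasDerivAt_newAngle (θ J : ℝ) :
    HasDerivAt (fun t => f.newAngle (t, J)) (f.jac (θ, J)) θ := by
  have h2 : HasDerivAt (fun t : ℝ => (t, J)) (1, 0) θ :=
    (hasDerivAt_id θ).prodMk (hasDerivAt_const θ J)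
  refine ((f.hasStrictFDerivAt_newAngle (θ, J)).hasFDerivAt.comp_hasDerivAt θ h2).congr_deriv ?_
  simp [jac]

lemma hasDerivAt_oldAction (θ J : ℝ) :
    HasDerivAt (fun t => f.oldAction (θ, t)) (f.jac (θ, J)) J := by
  have h2 : HasDerivAt (fun t : ℝ => (θ, t)) (0, 1) J :=
    (hasDerivAt_const J θ).prodMk (hasDerivAt_id J)
  refine ((f.hasStrictFDerivAt_oldAction (θ, J)).hasFDerivAt.comp_hasDerivAt J h2).congr_deriv ?_
  simp [jac, f.dh_symm (θ, J) (0, 1)]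

lemma continuous_oldAction : Continuous f.oldAction :=
  continuous_iff_continuousAt.2 fun x => (f.hasStrictFDerivAt_oldAction x).continuousAt

lemma continuous_F : Continuous f.F := f.smooth_F.continuous

lemma oldAction_F (θ I : ℝ) : f.oldAction (θ, (f.F (θ, I)).2) = I := by
  have := f.gen_snd θ I
  rw [deriv_h_fst] at this
  simp only [oldAction]
  linarith

lemma newAngle_F (θ I : ℝ) : f.newAngle (θ, (f.F (θ, I)).2) = (f.F (θ, I)).1 := by
  have := f.gen_fst θ I
  rw [deriv_h_snd] at this
  simp only [newAngle]
  linarith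

lemma surjective_F_snd (θ : ℝ) : Function.Surjective fun I => (f.F (θ, I)).2 := by
  set g : ℝ → ℝ := fun I => (f.F (θ, I)).2 with hg
  have hgc : Continuous g := (f.continuous_F.comp (by fun_prop)).snd
  have hk : Continuous fun J => f.oldAction (θ, J) := f.continuous_oldAction.comp (by fun_prop)
  have hkg : Function.LeftInverse (fun J => f.oldAction (θ, J)) g := f.oldAction_F θ
  have hcl : IsClosed (range g) := hkg.isClosed_range hk hgc
  have hmono := hgc.strictMono_of_inj hkg.injective
  rw [← range_eq_univ]
  refine (isPreconnected_range hgc).eq_univ_of_unbounded (fun hb => ?_) fun hb => ?_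
  · obtain ⟨I, hI⟩ := hcl.csInf_mem (range_nonempty g) hb
    have h : ∀ J, g I ≤ g J := fun J => hI ▸ csInf_le hb ⟨J, rfl⟩
    rcases hmono with hm | hm
    · exact (hm (sub_one_lt I)).not_ge (h _)
    · exact (hm (lt_add_one I)).not_ge (h _)
  · obtain ⟨I, hI⟩ := hcl.csSup_mem (range_nonempty g) hb
    have h : ∀ J, g J ≤ g I := fun J => hI ▸ le_csSup hb ⟨J, rfl⟩
    rcases hmono with hm | hm
    · exact (hm (lt_add_one I)).not_ge (h _)
    · exact (hm (sub_one_lt I)).not_ge (h _)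

lemma jac_ne_zero (x : ℝ × ℝ) : f.jac x ≠ 0 := by
  obtain ⟨θ, J⟩ := x
  obtain ⟨I, rfl⟩ := f.surjective_F_snd θ J
  have hF : DifferentiableAt ℝ (fun I => (f.F (θ, I)).2) I := by
    have := f.smooth_F.differentiable (by simp)
    fun_prop
  have h := (f.hasDerivAt_oldAction θ (f.F (θ, I)).2).comp I hF.hasDerivAt
  have h' : HasDerivAt (fun I : ℝ => I) 1 I := hasDerivAt_id I
  have heq : (fun t => f.oldAction (θ, t)) ∘ (fun I => (f.F (θ, I)).2) = fun I : ℝ => I :=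
    funext fun I => f.oldAction_F θ I
  rw [heq] at h
  exact left_ne_zero_of_mul_eq_one (h.unique h')

lemma jac_pos (x : ℝ × ℝ) : 0 < f.jac x := by
  obtain ⟨θ, J⟩ := x
  have hper : f.newAngle (1, J) = f.newAngle (0, J) + 1 := by
    have : (fun t => f.h 1 t) = fun t => f.h 0 t := funext fun t => by
      simpa using f.periodic_h 0 t
    have h := congrArg (fun φ => deriv φ J) this
    simp only [deriv_h_snd] at h
    simp only [newAngle, h]
    ring
  obtain ⟨c, -, hc⟩ := exists_hasDerivAt_eq_slope (fun t => f.newAngle (t, J))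
    (fun t => f.jac (t, J)) zero_lt_one
    (fun t _ => (f.hasDerivAt_newAngle t J).continuousAt.continuousWithinAt)
    (fun t _ => f.hasDerivAt_newAngle t J)
  have hc1 : f.jac (c, J) = 1 := by rw [hc, hper]; ring
  by_contra! hneg
  obtain ⟨t, -, ht⟩ := intermediate_value_uIcc (a := θ) (b := c) (f := fun t => f.jac (t, J))
    (f.continuous_jac.comp (by fun_prop)).continuousOn
    (show (0 : ℝ) ∈ _ from mem_uIcc.2 (Or.inl ⟨hneg, by simp [hc1]⟩))
  exact f.jac_ne_zero _ ht

lemma strictMono_newAngle_fst (J : ℝ) : StrictMono fun θ => f.newAngle (θ, J) :=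
  strictMono_of_deriv_pos fun θ => by
    rw [(f.hasDerivAt_newAngle θ J).deriv]
    exact f.jac_pos _

lemma strictMono_oldAction (θ : ℝ) : StrictMono fun J => f.oldAction (θ, J) :=
  strictMono_of_deriv_pos fun J => by
    rw [(f.hasDerivAt_oldAction θ J).deriv]
    exact f.jac_pos _

/-- The map tilts the verticals to the right. -/
lemma strictMono_F_fst (θ : ℝ) : StrictMono fun I => (f.F (θ, I)).1 :=
  strictMono_of_deriv_pos (f.twist θ)

lemma strictMono_newAngle_snd (θ : ℝ) : StrictMono fun J => f.newAngle (θ, J) := by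
  intro J J' hJ
  obtain ⟨I, rfl⟩ := f.surjective_F_snd θ J
  obtain ⟨I', rfl⟩ := f.surjective_F_snd θ J'
  have hI : I < I' := by
    have := f.strictMono_oldAction θ hJ
    simpa only [oldAction_F] using this
  simpa only [newAngle_F] using f.strictMono_F_fst θ hI

/-- The inverse map tilts the verticals to the left. -/
lemma fst_lt_of_F_snd_lt {p q : ℝ × ℝ} (h1 : (f.F p).1 = (f.F q).1)
    (h2 : (f.F p).2 < (f.F q).2) : q.1 < p.1 := by
  obtain ⟨θ, I⟩ := p
  obtain ⟨θ', I'⟩ := q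
  by_contra! h
  have := (f.strictMono_newAngle_snd θ h2).trans_le ((f.strictMono_newAngle_fst _).monotone h)
  simp only [newAngle_F] at this
  exact this.ne h1

/-- If the orbits of two points with the same angle are ordered one step forward and one step
backward, then the points agree. -/
lemma eq_of_ordered_neighbours {p q : ℝ × ℝ} (h0 : (f.F p).1 = (f.F q).1) (hm : q.1 ≤ p.1)
    (hp : (f.F (f.F q)).1 ≤ (f.F (f.F p)).1) : f.F p = f.F q := by
  refine Prod.ext h0 (le_antisymm ?_ ?_)
  · by_contra! h
    exact (f.fst_lt_of_F_snd_lt h0.symm h).not_ge hm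
  · rw [← Prod.mk.eta (p := f.F q), ← Prod.mk.eta (p := f.F p), h0] at hp
    exact (f.strictMono_F_fst _).le_iff_le.1 hp

/-- The shear `(θ, 𝓘) ↦ (θ, I)`. -/
noncomputable def sourceShear (x : ℝ × ℝ) : ℝ × ℝ := (x.1, f.oldAction x)

/-- The shear `(θ, 𝓘) ↦ (Θ, 𝓘)`. -/
noncomputable def targetShear (x : ℝ × ℝ) : ℝ × ℝ := (f.newAngle x, x.2)

lemma bijective_sourceShear : Function.Bijective f.sourceShear := by
  constructor
  · rintro ⟨θ, J⟩ ⟨θ', J'⟩ h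
    obtain ⟨rfl, h2⟩ := Prod.mk.inj h
    exact Prod.ext rfl ((f.strictMono_oldAction θ).injective h2)
  · rintro ⟨θ, I⟩
    exact ⟨(θ, (f.F (θ, I)).2), Prod.ext rfl (f.oldAction_F θ I)⟩

lemma injective_targetShear : Function.Injective f.targetShear := by
  rintro ⟨θ, J⟩ ⟨θ', J'⟩ h
  obtain ⟨h1, h2⟩ := Prod.mk.inj h
  obtain rfl : J = J' := h2
  exact Prod.ext ((f.strictMono_newAngle_fst J).injective h1) rfl

lemma continuous_sourceShear : Continuous f.sourceShear :=
  continuous_fst.prodMk f.continuous_oldAction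

lemma F_sourceShear (x : ℝ × ℝ) : f.F (f.sourceShear x) = f.targetShear x := by
  obtain ⟨θ, J⟩ := x
  obtain ⟨I, rfl⟩ := f.surjective_F_snd θ J
  simp only [sourceShear, targetShear, oldAction_F, newAngle_F]

lemma hasStrictFDerivAt_targetShear (x : ℝ × ℝ) : HasStrictFDerivAt f.targetShear
    ((fst ℝ ℝ ℝ + (fderiv ℝ f.dh x).flip (0, 1)).prod (snd ℝ ℝ ℝ)) x :=
  (f.hasStrictFDerivAt_newAngle x).prodMk hasStrictFDerivAt_snd

lemma hasStrictFDerivAt_sourceShear (x : ℝ × ℝ) : HasStrictFDerivAt f.sourceShear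
    ((fst ℝ ℝ ℝ).prod (snd ℝ ℝ ℝ + (fderiv ℝ f.dh x).flip (1, 0))) x :=
  hasStrictFDerivAt_fst.prodMk (f.hasStrictFDerivAt_oldAction x)

lemma image_F_eq (S : Set (ℝ × ℝ)) : f.F '' S = f.targetShear '' (f.sourceShear ⁻¹' S) := by
  conv_lhs => rw [← image_preimage_eq S f.bijective_sourceShear.2, image_image]
  simp only [F_sourceShear]

lemma isOpenMap_targetShear : IsOpenMap f.targetShear := by
  refine IsOpenMap.of_nhds_le fun x => ?_
  refine ((f.hasStrictFDerivAt_targetShear x).map_nhds_eq_of_surj ?_).ge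
  rw [LinearMap.range_eq_top]
  rintro ⟨a, b⟩
  have hj := f.jac_ne_zero x
  refine ⟨((a - b * fderiv ℝ f.dh x (0, 1) (0, 1)) / f.jac x, b), ?_⟩
  have hdec : ∀ s t : ℝ, ((s, t) : ℝ × ℝ) = s • (1, 0) + t • (0, 1) := by simp
  have : (fderiv ℝ f.dh x) ((a - b * fderiv ℝ f.dh x (0, 1) (0, 1)) / f.jac x, b) (0, 1) =
      (a - b * fderiv ℝ f.dh x (0, 1) (0, 1)) / f.jac x * (f.jac x - 1) +
        b * fderiv ℝ f.dh x (0, 1) (0, 1) := by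
    rw [hdec, map_add, map_smul, map_smul]
    simp [jac]
  simp [this]
  field_simp
  ring

lemma isOpenMap_F : IsOpenMap f.F := fun S hS => by
  rw [image_F_eq]
  exact f.isOpenMap_targetShear _ (hS.preimage f.continuous_sourceShear)

/-- The lift of a twist map, as a homeomorphism of the plane. -/
noncomputable def homeo : ℝ × ℝ ≃ₜ ℝ × ℝ :=
  (Equiv.ofBijective f.F f.bijective_F).toHomeomorphOfContinuousOpen f.continuous_F f.isOpenMap_F

lemma coe_homeo : ⇑f.homeo = f.F := rfl

/-- The lift of a twist map preserves the area. -/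
lemma volume_image_F {S : Set (ℝ × ℝ)} (hS : MeasurableSet S) :
    volume (f.F '' S) = volume S := by
  have hE : MeasurableSet (f.sourceShear ⁻¹' S) := f.continuous_sourceShear.measurable hS
  rw [image_F_eq]
  conv_rhs => rw [← image_preimage_eq S f.bijective_sourceShear.2]
  rw [← lintegral_abs_det_fderiv_eq_addHaar_image volume hE
      (fun x _ => (f.hasStrictFDerivAt_targetShear x).hasFDerivAt.hasFDerivWithinAt)
      f.injective_targetShear.injOn,
    ← lintegral_abs_det_fderiv_eq_addHaar_image volume hE
      (fun x _ => (f.hasStrictFDerivAt_sourceShear x).hasFDerivAt.hasFDerivWithinAt)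
      f.bijective_sourceShear.1.injOn]
  refine lintegral_congr fun x => ?_
  rw [ContinuousLinearMap.det_prod_snd, ContinuousLinearMap.det_fst_prod]
  simp [f.dh_symm x (0, 1)]

end TwistMap

end TwistGeometry

section CircleLifts

open Set Topology Filter

lemma Function.Periodic.exists_norm_le_of_continuous {E : Type*} [SeminormedAddCommGroup E]
    {f : ℝ → E} (hf : Function.Periodic f 1) (hc : Continuous f) : ∃ K, ∀ x, ‖f x‖ ≤ K := by
  obtain ⟨K, hK⟩ := (isCompact_Icc (a := (0 : ℝ)) (b := 0 + 1)).exists_bound_of_continuousOn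
    hc.norm.continuousOn
  refine ⟨K, fun x => ?_⟩
  obtain ⟨y, hy, hxy⟩ : f x ∈ f '' Icc 0 (0 + 1) := by
    rw [hf.image_Icc zero_lt_one]
    exact mem_range_self x
  simpa [hxy] using hK y hy

lemma Function.Periodic.uniformContinuous_of_continuous {E : Type*} [SeminormedAddCommGroup E]
    {f : ℝ → E} (hf : Function.Periodic f 1) (hc : Continuous f) : UniformContinuous f := by
  have huc : UniformContinuousOn f (Icc (-1) 2) :=
    isCompact_Icc.uniformContinuousOn_of_continuous hc.continuousOn
  rw [Metric.uniformContinuousOn_iff] at huc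
  rw [Metric.uniformContinuous_iff]
  intro ε hε
  obtain ⟨δ, hδ, h⟩ := huc ε hε
  refine ⟨min δ 1, by positivity, fun x y hxy => ?_⟩
  rw [lt_min_iff, Real.dist_eq, abs_lt, abs_lt] at hxy
  have h0 := Int.fract_nonneg x
  have h1 := Int.fract_lt_one x
  have hx : x - ⌊x⌋ = Int.fract x := rfl
  have := h (x - ⌊x⌋) (by constructor <;> linarith) (y - ⌊x⌋) (by constructor <;> linarith)
    (by rw [Real.dist_eq, abs_lt]; constructor <;> linarith)
  have hper : ∀ z, f (z - ⌊x⌋) = f z := fun z => by simpa using hf.sub_int_mul_eq (x := z) ⌊x⌋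
  rwa [hper, hper] at this

/-- Intervals of length at least `ε` which are pairwise disjoint modulo integer translations are
finitely many. -/
lemma finite_setOf_le_sub_of_disjoint {ι : Type*} {a b : ι → ℝ}
    (h : ∀ i j (k : ℤ) x, x ∈ Ioo (a i) (b i) → x + k ∈ Ioo (a j) (b j) → i = j)
    {ε : ℝ} (hε : 0 < ε) : {i | ε ≤ b i - a i}.Finite := by
  obtain ⟨N, hN⟩ := exists_nat_gt (2 / ε)
  have hN0 : (0 : ℝ) < N := lt_of_le_of_lt (by positivity) hN
  rw [div_lt_iff₀ hε] at hN
  have : NeZero N := ⟨by rintro rfl; simp at hN0⟩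
  have key : ∀ i ∈ {i | ε ≤ b i - a i},
      ((⌊a i * N⌋ + 1 : ℤ) : ℝ) / N ∈ Ioo (a i) (b i) := by
    intro i hi
    have hi' : ε ≤ b i - a i := hi
    have h1 := Int.lt_floor_add_one (a i * N)
    have h2 := Int.floor_le (a i * N)
    push_cast
    rw [mem_Ioo, lt_div_iff₀ hN0, div_lt_iff₀ hN0]
    exact ⟨h1, by nlinarith⟩
  refine Set.Finite.of_finite_image (f := fun i => ((⌊a i * N⌋ + 1 : ℤ) : ZMod N))
    (Set.toFinite _) fun i hi j hj hij => ?_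
  obtain ⟨k, hk⟩ := (ZMod.intCast_eq_intCast_iff_dvd_sub _ _ N).1 hij
  refine h i j k _ (key i hi) ?_
  have hk' : ((⌊a j * N⌋ + 1 : ℤ) : ℝ) - ((⌊a i * N⌋ + 1 : ℤ) : ℝ) = N * k := by
    exact_mod_cast hk
  have heq : ((⌊a i * N⌋ + 1 : ℤ) : ℝ) / N + k = ((⌊a j * N⌋ + 1 : ℤ) : ℝ) / N := by
    rw [div_add' _ _ _ hN0.ne']
    congr 1
    linarith
  rw [heq]
  exact key j hj

/-- A parametrized invariant circle (lifted to the plane) of a map `F` together with the lift `U`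
of the induced circle homeomorphism and a semiconjugacy `φ` of `U` to the translation by `α`. -/
structure InvariantCircle (F : ℝ × ℝ → ℝ × ℝ) (α : ℝ) where
  /-- the parametrization -/
  Γ : ℝ → ℝ × ℝ
  continuous_Γ : Continuous Γ
  injective_Γ : Function.Injective Γ
  Γ_add_one : ∀ x, Γ (x + 1) = Γ x + (1, 0)
  /-- the induced homeomorphism -/
  U : ℝ ≃o ℝ
  U_add_one : ∀ x, U (x + 1) = U x + 1
  F_Γ : ∀ x, F (Γ x) = Γ (U x)
  /-- the semiconjugacy to the rotation -/
  φ : ℝ → ℝ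
  continuous_φ : Continuous φ
  monotone_φ : Monotone φ
  φ_add_one : ∀ x, φ (x + 1) = φ x + 1
  φ_U : ∀ x, φ (U x) = φ x + α

lemma CircleDeg1Lift.continuous_of_semiconj_translate {u φ : CircleDeg1Lift} {α : ℝ}
    (hα : Irrational α) (hu : Function.Surjective u) (h : ∀ x, φ (u x) = φ x + α) :
    Continuous φ := by
  refine φ.monotone.continuous_of_denseRange ?_
  have hd : Dense (AddSubgroup.closure {α, 1} : Set ℝ) :=
    dense_addSubgroupClosure_pair_iff.2 (by simpa using hα)
  have hd' := (Homeomorph.addLeft (φ 0)).surjective.denseRange.dense_image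
    (Homeomorph.addLeft (φ 0)).continuous hd
  refine hd'.mono ?_
  rintro _ ⟨g, hg, rfl⟩
  have : ∀ y, y + g ∈ range φ ↔ y ∈ range φ := by
    induction hg using AddSubgroup.closure_induction with
    | mem g hg =>
      refine fun y => ⟨?_, ?_⟩
      · rintro ⟨x, hx⟩
        rcases hg with rfl | rfl
        · obtain ⟨z, rfl⟩ := hu x
          exact ⟨z, add_right_cancel ((h z).symm.trans hx)⟩
        · exact ⟨x - 1, by simpa [hx] using φ.map_sub_int x 1⟩
      · rintro ⟨x, rfl⟩
        rcases hg with rfl | rfl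
        · exact ⟨u x, h x⟩
        · exact ⟨x + 1, φ.map_add_one x⟩
    | zero => simp
    | add a b _ _ ha hb =>
      intro y
      rw [← add_assoc, hb, ha]
    | neg a ha ih =>
      intro y
      rw [← ih, neg_add_cancel_right]
  exact (this _).2 ⟨0, rfl⟩

lemma RestrictionHasRotationNumber.exists_invariantCircle {F : ℝ × ℝ → ℝ × ℝ} {T : Set (ℝ × ℝ)}
    {α : ℝ} (h : RestrictionHasRotationNumber F T α) (hα : Irrational α)
    (hF : Function.Injective F) (hT : F '' T = T) :
    ∃ c : InvariantCircle F α, range c.Γ = T := by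
  obtain ⟨Γ, ⟨hΓc, hΓi, hΓ1⟩, hΓT, u, hu, hτ⟩ := h
  have hinj : Function.Injective u := by
    have : Function.Injective (Γ ∘ u) := by
      rw [show Γ ∘ u = F ∘ Γ from funext fun x => (hu x).symm]
      exact hF.comp hΓi
    exact this.of_comp
  have hsurj : Function.Surjective u := by
    intro y
    have hy : Γ y ∈ F '' range Γ := by
      rw [hΓT, hT, ← hΓT]
      exact mem_range_self y
    obtain ⟨_, ⟨x, rfl⟩, hx⟩ := hy
    exact ⟨x, hΓi (by rw [← hu, hx])⟩
  obtain ⟨v, hv⟩ := CircleDeg1Lift.isUnit_iff_bijective.2 ⟨hinj, hsurj⟩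
  obtain ⟨φ, hφ⟩ := CircleDeg1Lift.semiconj_of_isUnit_of_translationNumber_eq
    (CircleDeg1Lift.isUnit_iff_bijective.2 ⟨hinj, hsurj⟩)
    (CircleDeg1Lift.translate (Multiplicative.ofAdd α)).isUnit
    (by rw [hτ, CircleDeg1Lift.translationNumber_translate])
  have hφ' : ∀ x, φ (u x) = φ x + α := fun x => by
    rw [hφ x, CircleDeg1Lift.translate_apply, add_comm]
  exact ⟨⟨Γ, hΓc, hΓi, hΓ1, CircleDeg1Lift.toOrderIso v,
    fun x => by simp, fun x => by simp [hv, hu], φ,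
    CircleDeg1Lift.continuous_of_semiconj_translate hα hsurj hφ', φ.monotone, φ.map_add_one,
    fun x => by simp [hv, hφ']⟩, hΓT⟩

namespace InvariantCircle

variable {F : ℝ × ℝ → ℝ × ℝ} {α : ℝ} (c : InvariantCircle F α)

lemma Γ_add_int (x : ℝ) (k : ℤ) : c.Γ (x + k) = c.Γ x + ((k : ℝ), 0) := by
  have hper : Function.Periodic (fun x => c.Γ x - (x, 0)) 1 := fun x => by
    simp only [c.Γ_add_one]
    ext <;> simp
  have h := hper.int_mul k x
  simp only [mul_one] at h
  rw [sub_eq_iff_eq_add] at h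
  rw [h]
  ext <;> simp [sub_add]

lemma φ_add_int (x : ℝ) (k : ℤ) : c.φ (x + k) = c.φ x + k := by
  have hper : Function.Periodic (fun x => c.φ x - x) 1 := fun x => by
    simp only [c.φ_add_one]
    ring
  have h := hper.int_mul k x
  simp only [mul_one] at h
  linarith

lemma U_zpow_add_int (n : ℤ) (x : ℝ) (k : ℤ) : (c.U ^ n) (x + k) = (c.U ^ n) x + k := by
  have hU : ∀ x, c.U (x + k) = c.U x + k := fun x => by
    have hper : Function.Periodic (fun x => c.U x - x) 1 := fun x => by
      simp only [c.U_add_one]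
      ring
    have h := hper.int_mul k x
    simp only [mul_one] at h
    linarith
  have hcomm : Commute c.U (OrderIso.addRight (k : ℝ)) := RelIso.ext hU
  exact DFunLike.congr_fun (hcomm.zpow_left n) x

lemma φ_U_inv (x : ℝ) : c.φ (c.U⁻¹ x) = c.φ x - α := by
  rw [eq_sub_iff_add_eq, ← c.φ_U, RelIso.apply_inv_self]

lemma φ_U_zpow (n : ℤ) (x : ℝ) : c.φ ((c.U ^ n) x) = c.φ x + n * α := by
  induction n generalizing x with
  | zero => simp
  | succ n ih =>
    rw [zpow_add_one, RelIso.mul_apply, ih, c.φ_U]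
    push_cast
    ring
  | pred n ih =>
    rw [zpow_sub_one, RelIso.mul_apply, ih, c.φ_U_inv]
    push_cast
    ring

lemma F_iterate_Γ (n : ℕ) (x : ℝ) : F^[n] (c.Γ x) = c.Γ ((c.U ^ (n : ℤ)) x) := by
  induction n with
  | zero => simp
  | succ n ih =>
    rw [Function.iterate_succ_apply', ih, c.F_Γ, Nat.cast_succ, add_comm, zpow_one_add,
      RelIso.mul_apply]

lemma F_Γ_U_inv (x : ℝ) : F (c.Γ (c.U⁻¹ x)) = c.Γ x := by
  rw [c.F_Γ, RelIso.apply_inv_self]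

lemma eq_of_φ_U_zpow_add_int (hα : Irrational α) {m n : ℤ} (k : ℤ) {x y : ℝ}
    (hxy : c.φ x = c.φ y) (h : c.φ ((c.U ^ m) x + k) = c.φ ((c.U ^ n) y)) : m = n := by
  by_contra hne
  rw [c.φ_add_int, c.φ_U_zpow, c.φ_U_zpow, hxy] at h
  refine ((hα.intCast_mul (m := n - m) (sub_ne_zero.2 (Ne.symm hne))).ne_int k) ?_
  push_cast
  linarith

lemma finite_setOf_le_of_φ_eq (hα : Irrational α) {x y : ℝ} (hxy : c.φ x = c.φ y) {ε : ℝ}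
    (hε : 0 < ε) : {n : ℤ | ε ≤ (c.U ^ n) y - (c.U ^ n) x}.Finite := by
  have hφ : ∀ n : ℤ, ∀ z ∈ Ioo ((c.U ^ n) x) ((c.U ^ n) y), c.φ z = c.φ x + n * α := by
    intro n z hz
    refine le_antisymm ?_ ?_
    · exact (c.monotone_φ hz.2.le).trans_eq (by rw [c.φ_U_zpow, hxy])
    · exact (c.φ_U_zpow n x).ge.trans (c.monotone_φ hz.1.le)
  refine finite_setOf_le_sub_of_disjoint (fun i j k z hz hzk => ?_) hε
  refine c.eq_of_φ_U_zpow_add_int (x := x) (y := x) hα k rfl ?_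
  rw [c.φ_add_int, c.φ_U_zpow, c.φ_U_zpow, ← hφ i z hz, ← hφ j _ hzk, c.φ_add_int]

lemma finite_setOf_le_of_gap (hα : Irrational α) {Z : Set ℝ} (hZU : ∀ x, c.U x ∈ Z ↔ x ∈ Z)
    (hZ1 : ∀ (x : ℝ) (k : ℤ), x + k ∈ Z ↔ x ∈ Z) {s t : ℝ} (hs : s ∈ Z)
    (hst : ∀ x ∈ Ioo s t, x ∉ Z) {ε : ℝ} (hε : 0 < ε) :
    {n : ℤ | ε ≤ (c.U ^ n) t - (c.U ^ n) s}.Finite := by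
  have hZn : ∀ (n : ℤ) x, (c.U ^ n) x ∈ Z ↔ x ∈ Z := by
    intro n
    induction n with
    | zero => simp
    | succ n ih => intro x; rw [zpow_add_one, RelIso.mul_apply, ih, hZU]
    | pred n ih =>
      intro x
      rw [zpow_sub_one, RelIso.mul_apply, ih, ← hZU, RelIso.apply_inv_self]
  have hgap : ∀ (n : ℤ), ∀ x ∈ Ioo ((c.U ^ n) s) ((c.U ^ n) t), x ∉ Z := by
    intro n x hx hxZ
    obtain ⟨y, rfl⟩ := (c.U ^ n).surjective x
    rw [mem_Ioo, (c.U ^ n).lt_iff_lt, (c.U ^ n).lt_iff_lt] at hx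
    exact hst y hx ((hZn n y).1 hxZ)
  refine finite_setOf_le_sub_of_disjoint (fun i j k z hz hzk => ?_) hε
  refine c.eq_of_φ_U_zpow_add_int (x := s) (y := s) hα k rfl (congrArg c.φ ?_)
  refine le_antisymm (not_lt.1 fun h => ?_) (not_lt.1 fun h => ?_)
  · refine hgap j ((c.U ^ i) s + k) ⟨h, ?_⟩ ((hZ1 _ k).2 ((hZn i s).2 hs))
    exact (add_lt_add_left hz.1 _).trans hzk.2
  · have hmem : (c.U ^ j) s - k ∈ Z := by
      rw [← hZ1 _ k, sub_add_cancel]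
      exact (hZn j s).2 hs
    refine hgap i ((c.U ^ j) s - k) ⟨lt_sub_iff_add_lt.2 h, ?_⟩ hmem
    exact (sub_lt_iff_lt_add.2 hzk.1).trans hz.2

lemma uniformContinuous_Γ : UniformContinuous c.Γ := by
  have hper : Function.Periodic (fun x => c.Γ x - (x, 0)) 1 := fun x => by
    simp only [c.Γ_add_one]
    ext <;> simp
  have h := (hper.uniformContinuous_of_continuous (c.continuous_Γ.sub (by fun_prop))).add
    (uniformContinuous_id.prodMk (uniformContinuous_const (b := (0 : ℝ))))
  have heq : c.Γ = fun x => c.Γ x - (x, 0) + (x, 0) := by simp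
  rw [heq]
  exact h

lemma exists_abs_Γ_fst_sub_le : ∃ K, ∀ x, |(c.Γ x).1 - x| ≤ K := by
  have hper : Function.Periodic (fun x => (c.Γ x).1 - x) 1 := fun x => by
    simp only [c.Γ_add_one, Prod.fst_add]
    ring
  exact hper.exists_norm_le_of_continuous (c.continuous_Γ.fst.sub continuous_id)

lemma exists_abs_φ_sub_le : ∃ K, ∀ x, |c.φ x - x| ≤ K := by
  have hper : Function.Periodic (fun x => c.φ x - x) 1 := fun x => by
    simp only [c.φ_add_one]
    ring
  exact hper.exists_norm_le_of_continuous (c.continuous_φ.sub continuous_id)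

lemma exists_forall_dist_Γ_lt {ε : ℝ} (hε : 0 < ε) :
    ∃ η > 0, ∀ x y, dist (c.Γ x) (c.Γ y) < η → dist x y < ε := by
  obtain ⟨K, hK⟩ := c.exists_abs_Γ_fst_sub_le
  set S : Set (ℝ × ℝ) := (Icc 0 1 ×ˢ Icc (-(2 * K + 1)) (2 * K + 2)) ∩ {z | ε ≤ dist z.1 z.2}
  have hS : IsCompact S := (isCompact_Icc.prod isCompact_Icc).inter_right
    (isClosed_le continuous_const (by fun_prop))
  have hΓ := c.continuous_Γ
  obtain ⟨η, hη, h⟩ := hS.exists_forall_le' (f := fun z => dist (c.Γ z.1) (c.Γ z.2))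
    (by fun_prop) (a := 0) (fun z hz => dist_pos.2 fun h => by
      have : ε ≤ dist z.1 z.2 := hz.2
      rw [c.injective_Γ h, dist_self] at this
      exact hε.not_ge this)
  refine ⟨min η 1, by positivity, fun x y hxy => ?_⟩
  by_contra! hε'
  rw [lt_min_iff] at hxy
  have hshift : dist (c.Γ (x + (-⌊x⌋ : ℤ))) (c.Γ (y + (-⌊x⌋ : ℤ))) = dist (c.Γ x) (c.Γ y) := by
    rw [c.Γ_add_int, c.Γ_add_int, dist_add_right]
  have h1 : dist (c.Γ x).1 (c.Γ y).1 < 1 := (le_max_left _ _).trans_lt hxy.2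
  have hx := abs_le.1 (hK x)
  have hy := abs_le.1 (hK y)
  rw [Real.dist_eq, abs_lt] at h1
  have hf0 := Int.floor_le x
  have hf1 := Int.lt_floor_add_one x
  refine hxy.1.not_ge (hshift ▸ h (x + (-⌊x⌋ : ℤ), y + (-⌊x⌋ : ℤ)) ⟨⟨?_, ?_⟩, ?_⟩)
  · push_cast
    constructor <;> linarith
  · push_cast
    constructor <;> linarith
  · simpa using hε'

lemma isClosed_range_Γ : IsClosed (range c.Γ) := by
  have : IsUniformEmbedding c.Γ := Metric.isUniformEmbedding_iff'.2
    ⟨fun ε hε => (Metric.uniformContinuous_iff.1 c.uniformContinuous_Γ ε hε).imp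
      fun δ h => ⟨h.1, fun h' => h.2 h'⟩,
    fun ε hε => (c.exists_forall_dist_Γ_lt hε).imp fun δ h => ⟨h.1, h.2 _ _⟩⟩
  exact this.isClosedEmbedding.isClosed_range

end InvariantCircle

end CircleLifts

section Uniqueness

open Set Topology Filter Metric

namespace TwistMap

variable {f : TwistMap} {α : ℝ}

/-- If two invariant circles with the same irrational rotation number intersect, the first one is
contained in the second one. -/
lemma range_subset_range_of_inter_nonempty (hα : Irrational α) (c₀ c₁ : InvariantCircle f.F α)
    (hne : (range c₀.Γ ∩ range c₁.Γ).Nonempty) : range c₀.Γ ⊆ range c₁.Γ := by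
  rintro _ ⟨τ, rfl⟩
  by_contra hτ
  set Z : Set ℝ := c₀.Γ ⁻¹' range c₁.Γ
  have hZc : IsClosed Z := c₁.isClosed_range_Γ.preimage c₀.continuous_Γ
  have hZ1 : ∀ (x : ℝ) (k : ℤ), x + k ∈ Z ↔ x ∈ Z := by
    have : ∀ (x : ℝ) (k : ℤ), x ∈ Z → x + k ∈ Z := by
      rintro x k ⟨y, hy⟩
      exact ⟨y + k, by rw [c₀.Γ_add_int, c₁.Γ_add_int, hy]⟩
    refine fun x k => ⟨fun h => ?_, this x k⟩
    simpa using this _ (-k) h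
  have hZU : ∀ x, c₀.U x ∈ Z ↔ x ∈ Z := by
    refine fun x => ⟨?_, ?_⟩
    · rintro ⟨y, hy⟩
      refine ⟨c₁.U⁻¹ y, f.bijective_F.1 ?_⟩
      rw [c₁.F_Γ_U_inv, c₀.F_Γ, hy]
    · rintro ⟨y, hy⟩
      exact ⟨c₁.U y, by rw [← c₁.F_Γ, ← c₀.F_Γ, hy]⟩
  obtain ⟨_, ⟨z, rfl⟩, hz⟩ := hne
  have hzZ : z ∈ Z := hz
  have hneI : (Z ∩ Iic τ).Nonempty := by
    refine ⟨z + (-⌈z - τ⌉ : ℤ), (hZ1 _ _).2 hzZ, ?_⟩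
    have := Int.le_ceil (z - τ)
    simp only [mem_Iic]
    push_cast
    linarith
  have hneS : (Z ∩ Ici τ).Nonempty := by
    refine ⟨z + (⌈τ - z⌉ : ℤ), (hZ1 _ _).2 hzZ, ?_⟩
    have := Int.le_ceil (τ - z)
    simp only [mem_Ici]
    linarith
  have hbI : BddAbove (Z ∩ Iic τ) := ⟨τ, fun x hx => hx.2⟩
  have hbS : BddBelow (Z ∩ Ici τ) := ⟨τ, fun x hx => hx.2⟩
  obtain ⟨hs, hsτ⟩ := (hZc.inter isClosed_Iic).csSup_mem hneI hbI
  obtain ⟨ht, hτt⟩ := (hZc.inter isClosed_Ici).csInf_mem hneS hbS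
  have hgap : ∀ x ∈ Ioo (sSup (Z ∩ Iic τ)) (sInf (Z ∩ Ici τ)), x ∉ Z := by
    intro x hx hxZ
    rcases le_total x τ with h | h
    · exact hx.1.not_ge (le_csSup hbI ⟨hxZ, h⟩)
    · exact hx.2.not_ge (csInf_le hbS ⟨hxZ, h⟩)
  generalize sSup (Z ∩ Iic τ) = s at *
  generalize sInf (Z ∩ Ici τ) = t at *
  have hst : s < t := by
    refine (show s ≤ τ from hsτ).lt_of_ne ?_ |>.trans_le hτt
    rintro rfl
    exact hτ hs
  obtain ⟨s', hs'⟩ := id hs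
  obtain ⟨t', ht'⟩ := id ht
  have hΓ₀ := c₀.continuous_Γ
  have hΓ₁ := c₁.continuous_Γ
  have hseg : ∀ r : unitInterval, s + r * (t - s) ∈ Icc s t := fun r => by
    have := r.2.1
    have := r.2.2
    constructor <;> nlinarith
  refine not_forall_exists_iterate_image_subset_closedBall f.homeo
    (fun S hS => f.volume_image_F hS)
    ⟨fun r => c₀.Γ (s + r * (t - s)), by fun_prop⟩
    ⟨fun r => c₁.Γ (s' + r * (t' - s')), by fun_prop⟩
    (by simp [hs']) (by simp [ht'])
    (by simpa using c₀.injective_Γ.ne hst.ne) ?_ ?_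
  · rintro _ ⟨⟨r, rfl⟩, r', hr'⟩
    have hmem : s + r * (t - s) ∈ Z := ⟨_, hr'⟩
    obtain ⟨h1, h2⟩ := hseg r
    simp only [ContinuousMap.coe_mk, mem_insert_iff, mem_singleton_iff, c₀.injective_Γ.eq_iff,
      Icc.coe_zero, Icc.coe_one,
      zero_mul, one_mul, add_zero, add_sub_cancel]
    by_contra! h
    refine hgap _ ⟨h1.lt_of_ne ?_, h2.lt_of_ne ?_⟩ hmem
    · exact fun h' => h.1 (by linarith)
    · exact fun h' => h.2 (by linarith)
  · intro ε hε
    rw [coe_homeo]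
    obtain ⟨η₁, hη₁, h₁⟩ := Metric.uniformContinuous_iff.1 c₁.uniformContinuous_Γ ε hε
    obtain ⟨η₂, hη₂, h₂⟩ := c₁.exists_forall_dist_Γ_lt hη₁
    obtain ⟨η₀, hη₀, h₀⟩ := Metric.uniformContinuous_iff.1 c₀.uniformContinuous_Γ (min ε η₂)
      (lt_min hε hη₂)
    obtain ⟨n, hn⟩ := ((c₀.finite_setOf_le_of_gap hα hZU hZ1 hs hgap hη₀).preimage
      (Nat.cast_injective (R := ℤ)).injOn).exists_notMem
    simp only [mem_preimage, mem_ofPred_eq, not_le] at hn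
    have hclose : ∀ y ∈ Icc s t, dist (f.F^[n] (c₀.Γ y)) (f.F^[n] (c₀.Γ s)) < min ε η₂ := by
      intro y hy
      rw [c₀.F_iterate_Γ, c₀.F_iterate_Γ]
      refine h₀ ?_
      have h1 := (c₀.U ^ (n : ℤ)).monotone hy.1
      have h2 := (c₀.U ^ (n : ℤ)).monotone hy.2
      rw [Real.dist_eq, abs_lt]
      constructor <;> linarith
    refine ⟨n, f.F^[n] (c₀.Γ s), ?_⟩
    rintro _ ⟨_, ⟨r, rfl⟩ | ⟨r, rfl⟩, rfl⟩
    · exact ((hclose _ (hseg r)).trans_le (min_le_left _ _)).le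
    · have hend := (hclose t ⟨hst.le, le_rfl⟩).trans_le (min_le_right _ _)
      rw [← hs', ← ht', c₁.F_iterate_Γ, c₁.F_iterate_Γ] at hend
      have hend' := h₂ _ _ hend
      simp only [ContinuousMap.coe_mk, mem_closedBall]
      rw [← hs', c₁.F_iterate_Γ, c₁.F_iterate_Γ]
      refine (h₁ (lt_of_le_of_lt ?_ hend')).le
      have hr0 := r.2.1
      have hr1 := r.2.2
      rw [Real.dist_eq, Real.dist_eq]
      rcases le_total s' t' with h | h
      · have e1 := (c₁.U ^ (n : ℤ)).monotone (show s' ≤ s' + r * (t' - s') by nlinarith)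
        have e2 := (c₁.U ^ (n : ℤ)).monotone (show s' + r * (t' - s') ≤ t' by nlinarith)
        rw [abs_of_nonneg (by linarith), abs_of_nonneg (by linarith)]
        linarith
      · have e1 := (c₁.U ^ (n : ℤ)).monotone (show s' + r * (t' - s') ≤ s' by nlinarith)
        have e2 := (c₁.U ^ (n : ℤ)).monotone (show t' ≤ s' + r * (t' - s') by nlinarith)
        rw [abs_of_nonpos (by linarith), abs_of_nonpos (by linarith)]
        linarith

/-- On disjoint invariant circles, the points whose neighbours on the orbit are weakly ordered are
strictly ordered. -/
lemma fst_lt_of_disjoint {c₀ c₁ : InvariantCircle f.F α}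
    (hd : Disjoint (range c₀.Γ) (range c₁.Γ)) {x z : ℝ}
    (h : ∀ n : ℤ, (c₁.Γ ((c₁.U ^ n) z)).1 ≤ (c₀.Γ ((c₀.U ^ n) x)).1) (n : ℤ) :
    (c₁.Γ ((c₁.U ^ n) z)).1 < (c₀.Γ ((c₀.U ^ n) x)).1 := by
  refine (h n).lt_of_ne fun heq => disjoint_left.1 hd ⟨(c₀.U ^ n) x, rfl⟩ ⟨(c₁.U ^ n) z, ?_⟩
  have hF : ∀ (c : InvariantCircle f.F α) (m : ℤ) (y : ℝ),
      f.F (c.Γ ((c.U ^ m) y)) = c.Γ ((c.U ^ (m + 1)) y) := fun c m y => by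
    rw [c.F_Γ, add_comm, zpow_one_add, RelIso.mul_apply]
  have key := f.eq_of_ordered_neighbours (p := c₀.Γ ((c₀.U ^ (n - 1)) x))
    (q := c₁.Γ ((c₁.U ^ (n - 1)) z)) (by simpa only [hF, sub_add_cancel] using heq.symm)
    (h _) (by simpa only [hF] using h _)
  simpa only [hF, sub_add_cancel] using key.symm

/-- Among the pairs of points of two invariant circles whose angles are ordered, there is one which
maximizes the difference of the angles of the semiconjugate rotations. -/
lemma exists_forall_φ_sub_le (c₀ c₁ : InvariantCircle f.F α) :
    ∃ x z, (c₀.Γ x).1 ≤ (c₁.Γ z).1 ∧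
      ∀ x' z', (c₀.Γ x').1 ≤ (c₁.Γ z').1 → c₀.φ x' - c₁.φ z' ≤ c₀.φ x - c₁.φ z := by
  obtain ⟨K₀, hK₀⟩ := c₀.exists_abs_Γ_fst_sub_le
  obtain ⟨K₁, hK₁⟩ := c₁.exists_abs_Γ_fst_sub_le
  obtain ⟨L₀, hL₀⟩ := c₀.exists_abs_φ_sub_le
  obtain ⟨L₁, hL₁⟩ := c₁.exists_abs_φ_sub_le
  simp only [abs_le] at hK₀ hK₁ hL₀ hL₁
  have hΓ₀ := c₀.continuous_Γ
  have hΓ₁ := c₁.continuous_Γ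
  have hφ₀ := c₀.continuous_φ
  have hφ₁ := c₁.continuous_φ
  set z₀ : ℝ := K₀ + K₁
  have h₀ : (c₀.Γ 0).1 ≤ (c₁.Γ z₀).1 := by linarith [hK₀ 0, hK₁ z₀]
  set d₀ : ℝ := c₀.φ 0 - c₁.φ z₀
  set S : Set (ℝ × ℝ) := (Icc 0 1 ×ˢ Icc (-(K₀ + K₁)) (1 + L₀ + L₁ - d₀)) ∩
    {w | (c₀.Γ w.1).1 ≤ (c₁.Γ w.2).1}
  have hSc : IsCompact S := (isCompact_Icc.prod isCompact_Icc).inter_right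
    (isClosed_le (by fun_prop) (by fun_prop))
  have hmem : ∀ x z, (c₀.Γ x).1 ≤ (c₁.Γ z).1 → d₀ ≤ c₀.φ x - c₁.φ z →
      (x + (-⌊x⌋ : ℤ), z + (-⌊x⌋ : ℤ)) ∈ S := by
    intro x z hxz hd
    have hf0 := Int.floor_le x
    have hf1 := Int.lt_floor_add_one x
    have := hK₀ x
    have := hK₁ z
    have := hL₀ x
    have := hL₁ z
    refine ⟨⟨?_, ?_⟩, ?_⟩
    · push_cast
      constructor <;> linarith
    · push_cast
      constructor <;> linarith
    · simpa only [mem_ofPred_eq, c₀.Γ_add_int, c₁.Γ_add_int, Prod.fst_add, add_le_add_iff_right]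
        using hxz
  obtain ⟨w, hw, hmax⟩ := hSc.exists_isMaxOn ⟨_, hmem 0 z₀ h₀ le_rfl⟩
    (f := fun w => c₀.φ w.1 - c₁.φ w.2) (by fun_prop)
  have hshift : ∀ x z, (c₀.Γ x).1 ≤ (c₁.Γ z).1 → d₀ ≤ c₀.φ x - c₁.φ z →
      c₀.φ x - c₁.φ z ≤ c₀.φ w.1 - c₁.φ w.2 := by
    intro x z hxz hd
    have := hmax (hmem x z hxz hd)
    simpa only [mem_ofPred_eq, c₀.φ_add_int, c₁.φ_add_int, add_sub_add_right_eq_sub] using this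
  refine ⟨w.1, w.2, hw.2, fun x z hxz => ?_⟩
  rcases le_total d₀ (c₀.φ x - c₁.φ z) with h | h
  · exact hshift x z hxz h
  · exact h.trans (hshift 0 z₀ h₀ le_rfl)

/-- Two pairs of orbits on disjoint invariant circles which are ordered and have a given angular
difference are uniformly separated. -/
lemma exists_forall_add_le_fst {c₀ c₁ : InvariantCircle f.F α}
    (hd : Disjoint (range c₀.Γ) (range c₁.Γ)) (t : ℝ) :
    ∃ δ > 0, ∀ x z, c₀.φ x - c₁.φ z = t →
      (∀ n : ℤ, (c₁.Γ ((c₁.U ^ n) z)).1 ≤ (c₀.Γ ((c₀.U ^ n) x)).1) →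
      ∀ n : ℤ, (c₁.Γ ((c₁.U ^ n) z)).1 + δ ≤ (c₀.Γ ((c₀.U ^ n) x)).1 := by
  obtain ⟨L₀, hL₀⟩ := c₀.exists_abs_φ_sub_le
  obtain ⟨L₁, hL₁⟩ := c₁.exists_abs_φ_sub_le
  simp only [abs_le] at hL₀ hL₁
  have hΓ₀ := c₀.continuous_Γ
  have hΓ₁ := c₁.continuous_Γ
  have hφ₀ := c₀.continuous_φ
  have hφ₁ := c₁.continuous_φ
  have hU₀ : ∀ n : ℤ, Continuous (c₀.U ^ n) := fun n => (c₀.U ^ n).continuous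
  have hU₁ : ∀ n : ℤ, Continuous (c₁.U ^ n) := fun n => (c₁.U ^ n).continuous
  set S : Set (ℝ × ℝ) := (Icc 0 1 ×ˢ Icc (-(L₀ + L₁ + t)) (1 + L₀ + L₁ - t)) ∩
    ({w | c₀.φ w.1 - c₁.φ w.2 = t} ∩
      ⋂ n : ℤ, {w | (c₁.Γ ((c₁.U ^ n) w.2)).1 ≤ (c₀.Γ ((c₀.U ^ n) w.1)).1})
  have hSc : IsCompact S := (isCompact_Icc.prod isCompact_Icc).inter_right
    ((isClosed_eq (by fun_prop) (by fun_prop)).inter (isClosed_iInter fun n => isClosed_le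
      ((hΓ₁.comp ((hU₁ n).comp continuous_snd)).fst)
      ((hΓ₀.comp ((hU₀ n).comp continuous_fst)).fst)))
  obtain ⟨δ, hδ, h⟩ := hSc.exists_forall_le' (f := fun w => (c₀.Γ w.1).1 - (c₁.Γ w.2).1)
    (by fun_prop) (a := 0) (fun w hw => by
      have := fst_lt_of_disjoint hd (fun n => mem_iInter.1 hw.2.2 n) 0
      simpa using this)
  refine ⟨δ, hδ, fun x z hxz hle n => ?_⟩
  set x' := (c₀.U ^ n) x with hx'
  set z' := (c₁.U ^ n) z with hz'
  have hxz' : c₀.φ x' - c₁.φ z' = t := by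
    rw [hx', hz', c₀.φ_U_zpow, c₁.φ_U_zpow]
    linarith
  have hmem : (x' + (-⌊x'⌋ : ℤ), z' + (-⌊x'⌋ : ℤ)) ∈ S := by
    have hf0 := Int.floor_le x'
    have hf1 := Int.lt_floor_add_one x'
    have := hL₀ x'
    have := hL₁ z'
    refine ⟨⟨?_, ?_⟩, ?_, mem_iInter.2 fun m => ?_⟩
    · push_cast
      constructor <;> linarith
    · push_cast
      constructor <;> linarith
    · simpa only [mem_ofPred_eq, c₀.φ_add_int, c₁.φ_add_int, add_sub_add_right_eq_sub] using hxz'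
    · simp only [mem_ofPred_eq, c₀.U_zpow_add_int, c₁.U_zpow_add_int, c₀.Γ_add_int, c₁.Γ_add_int,
        Prod.fst_add, add_le_add_iff_right]
      rw [hx', hz', ← RelIso.mul_apply, ← RelIso.mul_apply, ← zpow_add, ← zpow_add]
      exact hle _
  have := h _ hmem
  simp only [c₀.Γ_add_int, c₁.Γ_add_int, Prod.fst_add, add_sub_add_right_eq_sub] at this
  linarith

/-- Two invariant circles with the same irrational rotation number intersect. -/
lemma range_inter_range_nonempty (hα : Irrational α) (c₀ c₁ : InvariantCircle f.F α) :
    (range c₀.Γ ∩ range c₁.Γ).Nonempty := by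
  by_contra hemp
  have hd : Disjoint (range c₀.Γ) (range c₁.Γ) :=
    disjoint_iff_inter_eq_empty.2 (not_nonempty_iff_eq_empty.1 hemp)
  have hΓ₀ := c₀.continuous_Γ
  obtain ⟨x, z, hxz, hmax⟩ := exists_forall_φ_sub_le c₀ c₁
  obtain ⟨L, hL⟩ := c₀.exists_abs_φ_sub_le
  simp only [abs_le] at hL
  set B : Set ℝ := {y | c₀.φ y = c₀.φ x}
  have hBc : IsClosed B := isClosed_eq c₀.continuous_φ continuous_const
  have hBb : BddAbove B := ⟨c₀.φ x + L, fun y hy => by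
    have hy' : c₀.φ y = c₀.φ x := hy
    linarith [hL y]⟩
  have hbB := hBc.csSup_mem ⟨x, rfl⟩ hBb
  have hxb : x ≤ sSup B := le_csSup hBb rfl
  have hgt : ∀ y, sSup B < y → c₀.φ x < c₀.φ y := fun y hy =>
    (c₀.monotone_φ (hxb.trans hy.le)).lt_of_ne fun h => hy.not_ge (le_csSup hBb h.symm)
  generalize sSup B = b at *
  have hcont : ∀ n : ℤ, Continuous fun y => (c₀.Γ ((c₀.U ^ n) y)).1 := fun n =>
    (hΓ₀.comp (c₀.U ^ n).continuous).fst
  set I : Set ℝ := Icc x b ∩ ⋂ n : ℤ, {y | (c₁.Γ ((c₁.U ^ n) z)).1 ≤ (c₀.Γ ((c₀.U ^ n) y)).1}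
  have hIc : IsClosed I := isClosed_Icc.inter (isClosed_iInter fun n =>
    isClosed_le continuous_const (hcont n))
  have hbI : b ∈ I := by
    refine ⟨⟨hxb, le_rfl⟩, mem_iInter.2 fun n => ?_⟩
    refine ge_of_tendsto (((hcont n).tendsto b).mono_left (nhdsWithin_le_nhds (s := Ioi b))) ?_
    filter_upwards [self_mem_nhdsWithin] with y hy
    by_contra! h
    have := hmax _ _ h.le
    rw [c₀.φ_U_zpow, c₁.φ_U_zpow] at this
    linarith [hgt y hy]
  have hIb : BddBelow I := ⟨x, fun y hy => hy.1.1⟩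
  have haI := hIc.csInf_mem ⟨b, hbI⟩ hIb
  have hle : ∀ y ∈ I, sInf I ≤ y := fun y hy => csInf_le hIb hy
  generalize sInf I = a at *
  obtain ⟨⟨hxa, hab⟩, haI⟩ := haI
  have haI' := fun n => mem_iInter.1 haI n
  rcases hxa.eq_or_lt with rfl | hxa
  · exact hxz.not_gt (by simpa using fst_lt_of_disjoint hd haI' 0)
  obtain ⟨δ, hδ, hδ'⟩ := exists_forall_add_le_fst hd (c₀.φ a - c₁.φ z)
  obtain ⟨η, hη, hη'⟩ := Metric.uniformContinuous_iff.1 c₀.uniformContinuous_Γ δ hδ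
  have hfin := c₀.finite_setOf_le_of_φ_eq hα (show c₀.φ x = c₀.φ b from hbB.symm) hη
  have hclose : ∀ (y : ℝ) (n : ℤ), dist (c₀.Γ ((c₀.U ^ n) y)) (c₀.Γ ((c₀.U ^ n) a)) < δ →
      (c₁.Γ ((c₁.U ^ n) z)).1 ≤ (c₀.Γ ((c₀.U ^ n) y)).1 := by
    intro y n h
    have h1 := (le_max_left _ _).trans_lt h
    rw [Real.dist_eq, abs_lt] at h1
    linarith [hδ' a z rfl haI' n]
  have hev : ∀ᶠ y in 𝓝[<] a, ∀ n ∈ {n : ℤ | η ≤ (c₀.U ^ n) b - (c₀.U ^ n) x},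
      dist (c₀.Γ ((c₀.U ^ n) y)) (c₀.Γ ((c₀.U ^ n) a)) < δ := by
    refine (eventually_all_finite hfin).2 fun n _ => ?_
    have : Tendsto (fun y => c₀.Γ ((c₀.U ^ n) y)) (𝓝[<] a) (𝓝 (c₀.Γ ((c₀.U ^ n) a))) :=
      ((hΓ₀.comp (c₀.U ^ n).continuous).tendsto a).mono_left nhdsWithin_le_nhds
    exact this.eventually (ball_mem_nhds _ hδ)
  obtain ⟨y, hy, hxy, hya⟩ := (hev.and (Ioo_mem_nhdsLT hxa)).exists
  refine hya.not_ge (hle y ⟨⟨hxy.le, hya.le.trans hab⟩, mem_iInter.2 fun n => hclose y n ?_⟩)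
  by_cases hn : η ≤ (c₀.U ^ n) b - (c₀.U ^ n) x
  · exact hy n hn
  · refine hη' ?_
    have h1 := (c₀.U ^ n).monotone hxy.le
    have h2 := (c₀.U ^ n).monotone hya.le
    have h3 := (c₀.U ^ n).monotone hab
    rw [Real.dist_eq, abs_lt]
    constructor <;> linarith

end TwistMap

end Uniqueness

/-- Two invariant essential circles of an exact
area-preserving twist map on which the restrictions have the same irrational
rotation number coincide. -/
theorem uniqueness_of_invariant_curves (f : TwistMap) (T₀ T₁ : Set (ℝ × ℝ))
    (α : ℝ) (hα : Irrational α)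
    (hT₀ : IsEssentialCircle T₀) (hT₀inv : f.F '' T₀ = T₀)
    (hT₀rot : RestrictionHasRotationNumber f.F T₀ α)
    (hT₁ : IsEssentialCircle T₁) (hT₁inv : f.F '' T₁ = T₁)
    (hT₁rot : RestrictionHasRotationNumber f.F T₁ α) :
    T₀ = T₁ := by
  obtain ⟨c₀, rfl⟩ := hT₀rot.exists_invariantCircle hα f.bijective_F.1 hT₀inv
  obtain ⟨c₁, rfl⟩ := hT₁rot.exists_invariantCircle hα f.bijective_F.1 hT₁inv
  exact Set.Subset.antisymm
    (TwistMap.range_subset_range_of_inter_nonempty hα c₀ c₁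
      (TwistMap.range_inter_range_nonempty hα c₀ c₁))
    (TwistMap.range_subset_range_of_inter_nonempty hα c₁ c₀
      (TwistMap.range_inter_range_nonempty hα c₁ c₀))
end

section
/- Let α be an irrational number and set ω = (1, α) ∈ ℝ². Then ω satisfies the Bruno–Rüssmann condition, i.e. ∫_1^∞ ln(Ψ_ω(Q))/Q² dQ < ∞, if and only if α satisfies the Bruno condition ∑_{n≥0} log(q_{n+1})/q_n < ∞, where (q_n) are the denominators of the convergents of the continued fraction expansion of α. -/
/-!
STATEMENT 6 (for ω = (1, α) with α irrational, the Bruno–Rüssmann condition on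
ω is equivalent to the Bruno condition on α).
-/

open MeasureTheory

/-- `Ψ_ω (Q) = max { |k·ω|⁻¹ : k ∈ ℤⁿ, 0 < |k| ≤ Q }` (sup norm on `k`). -/
noncomputable def Psi (n : ℕ) (ω : Fin n → ℝ) (Q : ℝ) : ℝ :=
  sSup {x : ℝ | ∃ k : Fin n → ℤ, k ≠ 0 ∧ (∀ i, |(k i : ℝ)| ≤ Q) ∧
    x = |∑ i, (k i : ℝ) * ω i|⁻¹}

/-- The Bruno–Rüssmann condition: `∫_1^∞ ln (Ψ_ω (Q)) / Q² dQ < ∞`. -/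
def BRCondition (n : ℕ) (ω : Fin n → ℝ) : Prop :=
  ∫⁻ Q in Set.Ici (1:ℝ), ENNReal.ofReal (Real.log (Psi n ω Q) / Q ^ 2) < ⊤

/-- `q n` = the denominator of the `n`-th convergent of the continued fraction
expansion of `α`. -/
noncomputable def convDen (α : ℝ) (n : ℕ) : ℝ := (GenContFract.of α).dens n

/-- The Bruno condition: `∑ log (q (n+1)) / q n < ∞`. -/
def BrunoCondition (α : ℝ) : Prop :=
  Summable fun n : ℕ => Real.log (convDen α (n + 1)) / convDen α n

/-- The continued fraction of an irrational number has partial numerators `1` and positive integral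
partial denominators, and never terminates. -/
lemma exists_get?_s_of_irrational {α : ℝ} (hα : Irrational α) (n : ℕ) :
    ∃ z : ℤ, 1 ≤ z ∧ (GenContFract.of α).s.get? n = some ⟨1, z⟩ := by
  have hn : ¬ (GenContFract.of α).TerminatedAt n := fun h => by
    obtain ⟨q, hq⟩ := (GenContFract.terminates_iff_rat α).1 ⟨n, h⟩
    exact hα ⟨q, hq.symm⟩
  obtain ⟨⟨a, b⟩, hgp⟩ := Option.ne_none_iff_exists'.1 hn
  obtain ⟨ha, z, hz⟩ := GenContFract.of_partNum_eq_one_and_exists_int_partDen_eq hgp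
  have hb := GenContFract.of_one_le_get?_partDen (GenContFract.partDen_eq_s_b hgp)
  obtain rfl : a = 1 := ha
  obtain rfl : b = z := hz
  exact ⟨z, Int.cast_le.1 (Int.cast_one.trans_le hb), hgp⟩

lemma not_terminatedAt_of_irrational {α : ℝ} (hα : Irrational α) (n : ℕ) :
    ¬ (GenContFract.of α).TerminatedAt n := by
  obtain ⟨z, -, hz⟩ := exists_get?_s_of_irrational hα n
  simp [GenContFract.terminatedAt_iff_s_none, hz]

lemma exists_int_eq_nums_dens {α : ℝ} (hα : Irrational α) (n : ℕ) :
    ∃ p q : ℤ, (GenContFract.of α).nums n = p ∧ (GenContFract.of α).dens n = q := by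
  induction n using Nat.twoStepInduction with
  | zero => exact ⟨⌊α⌋, 1, by simp, by simp⟩
  | one =>
    obtain ⟨z, -, hz⟩ := exists_get?_s_of_irrational hα 0
    refine ⟨z * ⌊α⌋ + 1, z, ?_, ?_⟩
    · simp [GenContFract.first_num_eq hz]
    · simp [GenContFract.first_den_eq hz]
  | more n h₀ h₁ =>
    obtain ⟨p₀, q₀, hp₀, hq₀⟩ := h₀
    obtain ⟨p₁, q₁, hp₁, hq₁⟩ := h₁
    obtain ⟨z, -, hz⟩ := exists_get?_s_of_irrational hα (n + 1)
    refine ⟨z * p₁ + p₀, z * q₁ + q₀, ?_, ?_⟩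
    · simp [GenContFract.nums_recurrence hz hp₀ hp₁]
    · simp [GenContFract.dens_recurrence hz hq₀ hq₁]

lemma convDen_zero (α : ℝ) : convDen α 0 = 1 := by simp [convDen]

lemma monotone_convDen (α : ℝ) : Monotone (convDen α) :=
  monotone_nat_of_le_succ fun _ => GenContFract.of_den_mono

lemma one_le_convDen (α : ℝ) (n : ℕ) : 1 ≤ convDen α n :=
  convDen_zero α ▸ monotone_convDen α n.zero_le

lemma two_mul_convDen_le {α : ℝ} (hα : Irrational α) (n : ℕ) :
    2 * convDen α n ≤ convDen α (n + 2) := by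
  obtain ⟨z, hz1, hz⟩ := exists_get?_s_of_irrational hα (n + 1)
  have h : convDen α (n + 2) = z * convDen α (n + 1) + 1 * convDen α n :=
    GenContFract.dens_recurrence hz rfl rfl
  have hz1' : (1 : ℝ) ≤ z := by exact_mod_cast hz1
  have h1 := monotone_convDen α n.le_succ
  have h0 := one_le_convDen α n
  nlinarith

lemma exists_lt_convDen {α : ℝ} (hα : Irrational α) (Q : ℝ) : ∃ n, Q < convDen α n := by
  obtain ⟨n, hn⟩ := exists_nat_gt (Q + 1)
  refine ⟨n, ?_⟩
  have h : ((Nat.fib (n + 1) : ℕ) : ℝ) ≤ convDen α n :=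
    GenContFract.succ_nth_fib_le_of_nth_den (Or.inr (not_terminatedAt_of_irrational hα _))
  have h2 : (n : ℝ) ≤ (Nat.fib (n + 1) : ℕ) + 1 := by
    have h3 : n + 1 ≤ Nat.fib (n + 1) + 1 := Nat.le_fib_add_one (n + 1)
    exact_mod_cast (Nat.le_succ n).trans h3
  linarith

/-- The half-open intervals between consecutive convergent denominators cover `[1, ∞)`. -/
lemma exists_mem_Ico_convDen {α : ℝ} (hα : Irrational α) {Q : ℝ} (hQ : 1 ≤ Q) :
    ∃ n, Q ∈ Set.Ico (convDen α n) (convDen α (n + 1)) := by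
  classical
  have hex := exists_lt_convDen hα Q
  have hpos : Nat.find hex ≠ 0 := fun h => by
    have := Nat.find_spec hex
    rw [h, convDen_zero] at this
    exact this.not_ge hQ
  obtain ⟨n, hn⟩ := Nat.exists_eq_succ_of_ne_zero hpos
  exact ⟨n, not_lt.1 (Nat.find_min hex (hn ▸ n.lt_succ_self)), by simpa only [hn] using Nat.find_spec hex⟩

lemma abs_convDen_mul_sub_nums_le {α : ℝ} (hα : Irrational α) (n : ℕ) :
    |convDen α n * α - (GenContFract.of α).nums n| ≤ 1 / convDen α (n + 1) := by
  have h := GenContFract.abs_sub_convs_le (not_terminatedAt_of_irrational hα n)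
  change _ ≤ 1 / (convDen α n * convDen α (n + 1)) at h
  have h0 : 0 < convDen α n := zero_lt_one.trans_le (one_le_convDen α n)
  have h1 : 0 < convDen α (n + 1) := zero_lt_one.trans_le (one_le_convDen α (n + 1))
  have e : convDen α n * α - (GenContFract.of α).nums n
      = convDen α n * (α - (GenContFract.of α).convs n) := by
    rw [GenContFract.conv_eq_num_div_den]
    change _ = convDen α n * (α - _ / convDen α n)
    field_simp
  rw [e, abs_mul, abs_of_pos h0]
  calc _ ≤ convDen α n * (1 / (convDen α n * convDen α (n + 1))) := by gcongr
    _ = _ := by field_simp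

/-- Integer linear forms in `1, α` with `α`-coefficient smaller than the `n`-th convergent
denominator `q` are at least `q⁻²` in absolute value. -/
lemma inv_abs_add_mul_le {α : ℝ} (hα : Irrational α) {n : ℕ} {a b : ℤ}
    (hab : a ≠ 0 ∨ b ≠ 0) (hb : |(b : ℝ)| < convDen α n) :
    |a + b * α|⁻¹ ≤ convDen α n ^ 2 := by
  have hq1 := one_le_convDen α n
  have hq0 : 0 < convDen α n := zero_lt_one.trans_le hq1
  suffices h : 1 ≤ convDen α n ^ 2 * |a + b * α| by
    have hL : 0 < |a + b * α| := by
      by_contra hL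
      have : |a + b * α| = 0 := le_antisymm (not_lt.1 hL) (abs_nonneg _)
      rw [this] at h
      linarith
    rw [inv_le_iff_one_le_mul₀ hL]
    exact h
  rcases eq_or_ne b 0 with rfl | hb0
  · have ha : a ≠ 0 := by simpa using hab
    have ha1 : (1 : ℝ) ≤ |(a : ℝ)| := by exact_mod_cast Int.one_le_abs ha
    simp only [Int.cast_zero, zero_mul, add_zero]
    exact one_le_mul_of_one_le_of_one_le (one_le_pow₀ hq1) ha1
  obtain ⟨p, q, hp, hq⟩ := exists_int_eq_nums_dens hα n
  obtain ⟨p', q', hp', hq'⟩ := exists_int_eq_nums_dens hα (n + 1)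
  have hdet : p * q' - q * p' = (-1) ^ (n + 1) := by
    have h := SimpContFract.determinant (s := SimpContFract.of α)
      (not_terminatedAt_of_irrational hα n)
    change (GenContFract.of α).nums n * (GenContFract.of α).dens (n + 1) -
      (GenContFract.of α).dens n * (GenContFract.of α).nums (n + 1) = _ at h
    rw [hp, hq, hp', hq'] at h
    exact_mod_cast h
  have hqc : convDen α n = q := hq
  have hcop : IsCoprime q p := by
    rcases neg_one_pow_eq_or ℤ (n + 1) with h | h
    · exact ⟨-p', q', by linarith⟩
    · exact ⟨p', -q', by linarith⟩
  have hbq : |b| < q := by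
    rw [hqc] at hb
    exact_mod_cast hb
  have hD : a * q + b * p ≠ 0 := fun h => by
    have hdvd : q ∣ b := hcop.dvd_of_dvd_mul_right ⟨-a, by linarith⟩
    have := Int.le_of_dvd (abs_pos.2 hb0) ((dvd_abs q b).2 hdvd)
    omega
  have hD1 : (1 : ℝ) ≤ |(a * q + b * p : ℝ)| := by exact_mod_cast Int.one_le_abs hD
  have herr : |(q : ℝ) * α - p| ≤ 1 / q := by
    have h := abs_convDen_mul_sub_nums_le hα n
    rw [hp, hqc] at h
    refine h.trans (one_div_le_one_div_of_le (hqc ▸ hq0) ?_)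
    exact hqc ▸ monotone_convDen α n.le_succ
  have hb1 : |(b : ℝ)| ≤ q - 1 := by exact_mod_cast Int.le_sub_one_of_lt hbq
  rw [hqc] at hq0 hq1 ⊢
  have htri : |(a * q + b * p : ℝ)| ≤ q * |a + b * α| + (q - 1) * (1 / q) := by
    calc |(a * q + b * p : ℝ)| = |q * (a + b * α) - b * (q * α - p)| := by ring_nf
      _ ≤ |q * (a + b * α)| + |b * (q * α - p)| := abs_sub _ _
      _ = q * |a + b * α| + |(b : ℝ)| * |q * α - p| := by
        rw [abs_mul, abs_mul, abs_of_pos hq0]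
      _ ≤ _ := by gcongr
  have e : ((q : ℝ) - 1) * (1 / q) = 1 - 1 / q := by field_simp
  have h1 : 1 / (q : ℝ) ≤ q * |a + b * α| := by linarith
  rw [div_le_iff₀ hq0] at h1
  linarith

lemma inv_abs_sum_mul_le {α : ℝ} (hα : Irrational α) {n : ℕ} {Q : ℝ} (hQ : Q < convDen α n)
    {x : ℝ} (hx : x ∈ {x : ℝ | ∃ k : Fin 2 → ℤ, k ≠ 0 ∧ (∀ i, |(k i : ℝ)| ≤ Q) ∧
      x = |∑ i, (k i : ℝ) * ![1, α] i|⁻¹}) : x ≤ convDen α n ^ 2 := by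
  obtain ⟨k, hk, hkQ, rfl⟩ := hx
  have h := inv_abs_add_mul_le hα (a := k 0) (b := k 1) (n := n) ?_ ((hkQ 1).trans_lt hQ)
  · simpa [Fin.sum_univ_two] using h
  · by_contra! h
    exact hk (funext fun i => by fin_cases i <;> simp [h.1, h.2])

lemma Psi_le_sq_convDen {α : ℝ} (hα : Irrational α) {n : ℕ} {Q : ℝ} (hQ : Q < convDen α n) :
    Psi 2 ![1, α] Q ≤ convDen α n ^ 2 :=
  Real.sSup_le (fun _ hx => inv_abs_sum_mul_le hα hQ hx) (sq_nonneg _)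

lemma convDen_succ_le_Psi {α : ℝ} (hα : Irrational α) {n : ℕ} {Q : ℝ}
    (hQ : (|α| + 1) * convDen α n ≤ Q) : convDen α (n + 1) ≤ Psi 2 ![1, α] Q := by
  obtain ⟨p, q, hp, hq⟩ := exists_int_eq_nums_dens hα n
  have hqc : convDen α n = q := hq
  have hq1 := one_le_convDen α n
  have hq1' := one_le_convDen α (n + 1)
  have herr := abs_convDen_mul_sub_nums_le hα n
  rw [hp] at herr
  rw [hqc] at hQ hq1 herr
  have hq0 : q ≠ 0 := by
    rintro rfl
    norm_num at hq1
  have hp_le : |(p : ℝ)| ≤ Q := by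
    have h1 : 1 / convDen α (n + 1) ≤ 1 := by
      rw [div_le_one (by linarith)]
      exact hq1'
    have h2 : |(p : ℝ)| ≤ |q * α| + |q * α - p| := by
      simpa using abs_sub (q * α : ℝ) (q * α - p)
    rw [abs_mul, abs_of_pos (by linarith : (0 : ℝ) < q)] at h2
    nlinarith
  have hq_le : |(q : ℝ)| ≤ Q := by
    rw [abs_of_pos (by linarith : (0 : ℝ) < q)]
    nlinarith [abs_nonneg α]
  have hne : (q : ℝ) * α - p ≠ 0 := ((hα.intCast_mul hq0).sub_intCast p).ne_zero
  obtain ⟨m, hm⟩ := exists_lt_convDen hα Q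
  refine le_csSup_of_le ⟨_, fun _ hx => inv_abs_sum_mul_le hα hm hx⟩
    ⟨![-p, q], ?_, ?_, rfl⟩ ?_
  · intro h
    exact hq0 (by simpa using congrFun h 1)
  · intro i
    fin_cases i
    · simpa using hp_le
    · simpa using hq_le
  · have e : ∑ i, ((![-p, q] : Fin 2 → ℤ) i : ℝ) * ![1, α] i = q * α - p := by
      simp [Fin.sum_univ_two]
      ring
    rw [e, le_inv_comm₀ (by linarith) (abs_pos.2 hne)]
    simpa using herr

lemma lintegral_Ioi_ofReal_div_sq {a L : ℝ} (ha : 0 < a) (hL : 0 ≤ L) :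
    ∫⁻ Q in Set.Ioi a, ENNReal.ofReal (L / Q ^ 2) = ENNReal.ofReal (L / a) := by
  have e : ∀ Q : ℝ, L / Q ^ 2 = L * Q ^ (-2 : ℝ) := fun Q => by
    rw [show (-2 : ℝ) = ((-2 : ℤ) : ℝ) by norm_num, Real.rpow_intCast]
    rfl
  have hi : IntegrableOn (fun Q : ℝ => L * Q ^ (-2 : ℝ)) (Set.Ioi a) :=
    (integrableOn_Ioi_rpow_of_lt (by norm_num) ha).const_mul L
  simp_rw [e]
  rw [← ofReal_integral_eq_lintegral_ofReal hi, integral_const_mul,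
    integral_Ioi_rpow_of_lt (by norm_num) ha]
  · norm_num [Real.rpow_neg_one]
    rfl
  · refine (ae_restrict_iff' measurableSet_Ioi).2 (Filter.Eventually.of_forall fun Q hQ => ?_)
    have : 0 < Q := ha.trans hQ
    positivity

lemma ofReal_div_le_lintegral_Ico {a b L : ℝ} (ha : 0 < a) (hab : 2 * a ≤ b) (hL : 0 ≤ L) :
    ENNReal.ofReal (L / (4 * a)) ≤ ∫⁻ Q in Set.Ico a b, ENNReal.ofReal (L / Q ^ 2) := by
  calc ENNReal.ofReal (L / (4 * a))
      = ∫⁻ _ in Set.Ico a (2 * a), ENNReal.ofReal (L / (2 * a) ^ 2) := by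
        rw [setLIntegral_const, Real.volume_Ico, ← ENNReal.ofReal_mul (by positivity)]
        congr 1
        field_simp
        ring
    _ ≤ ∫⁻ Q in Set.Ico a (2 * a), ENNReal.ofReal (L / Q ^ 2) := by
        refine setLIntegral_mono' measurableSet_Ico fun Q hQ => ENNReal.ofReal_le_ofReal ?_
        have : 0 < Q := ha.trans_le hQ.1
        have := hQ.2.le
        gcongr
    _ ≤ _ := lintegral_mono_set (Set.Ico_subset_Ico_right hab)

lemma brCondition_of_brunoCondition {α : ℝ} (hα : Irrational α) (h : BrunoCondition α) :
    BRCondition 2 ![1, α] := by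
  have hsub : Set.Ici (1 : ℝ) ⊆ ⋃ n, Set.Ico (convDen α n) (convDen α (n + 1)) :=
    fun Q hQ => Set.mem_iUnion.2 (exists_mem_Ico_convDen hα hQ)
  refine (lintegral_mono_set hsub).trans_lt ((lintegral_iUnion_le _ _).trans_lt ?_)
  refine (ENNReal.tsum_le_tsum fun n => ?_).trans_lt (h.mul_left 2).tsum_ofReal_lt_top
  have h0 : 0 < convDen α n := zero_lt_one.trans_le (one_le_convDen α n)
  have hL : 0 ≤ Real.log (convDen α (n + 1)) := Real.log_nonneg (one_le_convDen α _)
  calc ∫⁻ Q in Set.Ico (convDen α n) (convDen α (n + 1)),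
        ENNReal.ofReal (Real.log (Psi 2 ![1, α] Q) / Q ^ 2)
      ≤ ∫⁻ Q in Set.Ico (convDen α n) (convDen α (n + 1)),
        ENNReal.ofReal (2 * Real.log (convDen α (n + 1)) / Q ^ 2) := by
        refine setLIntegral_mono' measurableSet_Ico fun Q hQ => ENNReal.ofReal_le_ofReal ?_
        gcongr
        have hPsi := Psi_le_sq_convDen hα hQ.2
        have hPsi0 : 0 ≤ Psi 2 ![1, α] Q := Real.sSup_nonneg (by
          rintro _ ⟨k, -, -, rfl⟩
          positivity)
        rcases hPsi0.eq_or_lt with h' | h'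
        · rw [← h', Real.log_zero]
          positivity
        · simpa using Real.log_le_log h' hPsi
    _ ≤ ∫⁻ Q in Set.Ici (convDen α n),
        ENNReal.ofReal (2 * Real.log (convDen α (n + 1)) / Q ^ 2) :=
        lintegral_mono_set Set.Ico_subset_Ici_self
    _ = ENNReal.ofReal (2 * Real.log (convDen α (n + 1)) / convDen α n) := by
        rw [setLIntegral_congr Ioi_ae_eq_Ici.symm, lintegral_Ioi_ofReal_div_sq h0 (by positivity)]
    _ = _ := by rw [mul_div_assoc]

/-- The terms of the Bruno series whose indices have a fixed parity are controlled by integrals over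
disjoint intervals. -/
lemma summable_log_convDen_of_brCondition {α : ℝ} (hα : Irrational α)
    (h : BRCondition 2 ![1, α]) (e : ℕ) :
    Summable fun n : ℕ => Real.log (convDen α (2 * n + e + 1)) / convDen α (2 * n + e) := by
  set C : ℝ := |α| + 1 with hC
  have hC1 : 1 ≤ C := by simp [hC]
  have hC0 : 0 < C := zero_lt_one.trans_le hC1
  let c : ℕ → ℝ := fun n => C * convDen α (2 * n + e)
  have hc1 : ∀ n, 1 ≤ c n := fun n => one_le_mul_of_one_le_of_one_le hC1 (one_le_convDen α _)
  have hcmono : Monotone c := fun m n hmn =>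
    mul_le_mul_of_nonneg_left (monotone_convDen α (by omega)) hC0.le
  have hc2 : ∀ n, 2 * c n ≤ c (n + 1) := fun n => by
    have h2 := mul_le_mul_of_nonneg_left (two_mul_convDen_le hα (2 * n + e)) hC0.le
    simp only [c]
    rw [show 2 * (n + 1) + e = 2 * n + e + 2 by ring]
    linarith
  have hL : ∀ n, 0 ≤ Real.log (convDen α (n + 1)) := fun n => Real.log_nonneg (one_le_convDen α _)
  suffices hs : Summable fun n => Real.log (convDen α (2 * n + e + 1)) / (4 * c n) by
    refine (hs.mul_left (4 * C)).congr fun n => ?_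
    have := one_le_convDen α (2 * n + e)
    simp only [c]
    field_simp
  have hsum : ∑' n, ENNReal.ofReal (Real.log (convDen α (2 * n + e + 1)) / (4 * c n)) < ⊤ := by
    refine lt_of_le_of_lt ?_ h
    calc ∑' n, ENNReal.ofReal (Real.log (convDen α (2 * n + e + 1)) / (4 * c n))
        ≤ ∑' n, ∫⁻ Q in Set.Ico (c n) (c (n + 1)),
          ENNReal.ofReal (Real.log (Psi 2 ![1, α] Q) / Q ^ 2) := by
          refine ENNReal.tsum_le_tsum fun n => ?_
          refine (ofReal_div_le_lintegral_Ico (zero_lt_one.trans_le (hc1 n)) (hc2 n)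
            (hL _)).trans ?_
          refine setLIntegral_mono' measurableSet_Ico fun Q hQ => ENNReal.ofReal_le_ofReal ?_
          gcongr
          · exact zero_lt_one.trans_le (one_le_convDen α _)
          · exact convDen_succ_le_Psi hα hQ.1
      _ = ∫⁻ Q in ⋃ n, Set.Ico (c n) (c (n + 1)),
          ENNReal.ofReal (Real.log (Psi 2 ![1, α] Q) / Q ^ 2) :=
          (lintegral_iUnion (fun _ => measurableSet_Ico)
            hcmono.pairwise_disjoint_on_Ico_succ _).symm
      _ ≤ _ := lintegral_mono_set (Set.iUnion_subset fun n Q hQ => (hc1 n).trans hQ.1)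
  refine (ENNReal.summable_toReal hsum.ne).congr fun n => ENNReal.toReal_ofReal ?_
  exact div_nonneg (hL _) (by linarith [hc1 n])

lemma brunoCondition_of_brCondition {α : ℝ} (hα : Irrational α) (h : BRCondition 2 ![1, α]) :
    BrunoCondition α := by
  set f : ℕ → ℝ := fun n => Real.log (convDen α (n + 1)) / convDen α n
  have h0 : Summable fun n => f (2 * n) := summable_log_convDen_of_brCondition hα h 0
  have h1 : Summable fun n => f (2 * n + 1) := summable_log_convDen_of_brCondition hα h 1
  exact (h0.hasSum.even_add_odd h1.hasSum).summable

/-- For `α` irrational, `ω = (1, α)` satisfies the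
Bruno–Rüssmann condition iff `α` satisfies the Bruno condition. -/
theorem brCondition_iff_brunoCondition (α : ℝ) (hα : Irrational α) :
    BRCondition 2 ![1, α] ↔ BrunoCondition α :=
  ⟨brunoCondition_of_brCondition hα, brCondition_of_brunoCondition hα⟩
end
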